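/- arXiv:1708.08820 — 2 statements merged into one kernel-verified Lean document; each statement's English description precedes it below -/
import Mathlib

section
/- Suppose the real random variable X satisfies: (1) E[exp(b |X|^a)] < ∞ for some b > 0 and some a > 1, and (2) E[exp(b′ X²)] = ∞ for every b′ > 0. Then the entire function z ↦ E[exp(z X)] has a zero z ∈ ℂ with Re z ≠ 0 (i.e., a zero that is not purely imaginary). -/
open MeasureTheory

lemma exists_log_on_ball {E : ℂ → ℂ} {c w : ℂ} {r : ℝ} (hr : 0 < r)
    (hE : DifferentiableOn ℂ E (Metric.ball c r)) (hne : ∀ z ∈ Metric.ball c r, E z ≠ 0)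
    (hw : Complex.exp w = E c) :
    ∃ g : ℂ → ℂ, DifferentiableOn ℂ g (Metric.ball c r) ∧ g c = w ∧
      ∀ z ∈ Metric.ball c r, Complex.exp (g z) = E z := by
  have hE' : DifferentiableOn ℂ (deriv E) (Metric.ball c r) := hE.deriv Metric.isOpen_ball
  obtain ⟨g, hgc, hg⟩ := ((hE'.div hE hne).isExactOn_ball).with_val_at c w
  refine ⟨g, fun z hz => (hg z hz).differentiableAt.differentiableWithinAt, hgc, ?_⟩
  have hd : ∀ z ∈ Metric.ball c r,
      HasDerivAt (fun z => Complex.exp (-g z) * E z) 0 z := by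
    intro z hz
    have h1 := ((hg z hz).neg.cexp).mul
      ((hE.differentiableAt (Metric.isOpen_ball.mem_nhds hz)).hasDerivAt)
    refine h1.congr_deriv ?_
    have := hne z hz
    simp only [Pi.div_apply, Pi.neg_apply]
    field_simp
    ring
  intro z hz
  have hconst := (convex_ball c r).is_const_of_fderivWithin_eq_zero (𝕜 := ℂ)
    (f := fun z => Complex.exp (-g z) * E z)
    (fun z hz => (hd z hz).differentiableAt.differentiableWithinAt)
    (fun z hz => by
      rw [((hd z hz).hasFDerivAt.hasFDerivWithinAt).fderivWithin
        (Metric.isOpen_ball.uniqueDiffWithinAt hz)]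
      ext; simp) hz (Metric.mem_ball_self hr)
  simp only [hgc, Complex.exp_neg, hw] at hconst
  rw [inv_mul_cancel₀ (hne c (Metric.mem_ball_self hr)),
    inv_mul_eq_one₀ (Complex.exp_ne_zero _)] at hconst
  exact hconst

lemma norm_dslope_zero_le {f : ℂ → ℂ} {R s B : ℝ} (hs : 0 < s) (hsR : s < R)
    (hf : DifferentiableOn ℂ f (Metric.ball 0 R)) (hB : ∀ z ∈ Metric.closedBall 0 s, ‖f z‖ ≤ B) :
    DifferentiableOn ℂ (dslope f 0) (Metric.ball 0 R) ∧
      ∀ z ∈ Metric.closedBall 0 s, ‖dslope f 0 z‖ ≤ 2 * B / s := by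
  have hd : DifferentiableOn ℂ (dslope f 0) (Metric.ball 0 R) :=
    (Complex.differentiableOn_dslope (Metric.ball_mem_nhds 0 (hs.trans hsR))).2 hf
  refine ⟨hd, fun z hz => ?_⟩
  have hcl : closure (Metric.ball (0 : ℂ) s) = Metric.closedBall 0 s := closure_ball 0 hs.ne'
  have hdc : DiffContOnCl ℂ (dslope f 0) (Metric.ball 0 s) :=
    DifferentiableOn.diffContOnCl (hd.mono (hcl ▸ Metric.closedBall_subset_ball hsR))
  refine Complex.norm_le_of_forall_mem_frontier_norm_le Metric.isBounded_ball hdc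
    (fun w hw => ?_) (hcl ▸ hz)
  rw [frontier_ball 0 hs.ne', mem_sphere_zero_iff_norm] at hw
  have h1 : ‖w * dslope f 0 w‖ ≤ B + B := by
    have := sub_smul_dslope f 0 w
    simp only [sub_zero, smul_eq_mul] at this
    rw [this]
    exact (norm_sub_le _ _).trans (add_le_add (hB w (by simp [hw])) (hB 0 (by simp [hs.le])))
  rw [norm_mul, hw] at h1
  rw [le_div_iff₀ hs]
  linarith

/-- Third-order Taylor expansion with a remainder controlled by the supremum. -/
lemma exists_taylor_four {f : ℂ → ℂ} {R s B : ℝ} (hs : 0 < s) (hsR : s < R)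
    (hf : DifferentiableOn ℂ f (Metric.ball 0 R)) (hB : ∀ z ∈ Metric.closedBall 0 s, ‖f z‖ ≤ B)
    (hf0 : f 0 = 0) :
    ∃ (p₁ p₂ p₃ : ℂ) (r : ℂ → ℂ), (∀ z, f z = p₁ * z + p₂ * z ^ 2 + p₃ * z ^ 3 + z ^ 4 * r z) ∧
      ∀ z ∈ Metric.closedBall 0 s, ‖r z‖ ≤ 16 * B / s ^ 4 := by
  obtain ⟨d1, b1⟩ := norm_dslope_zero_le hs hsR hf hB
  obtain ⟨d2, b2⟩ := norm_dslope_zero_le hs hsR d1 b1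
  obtain ⟨d3, b3⟩ := norm_dslope_zero_le hs hsR d2 b2
  obtain ⟨d4, b4⟩ := norm_dslope_zero_le hs hsR d3 b3
  set f1 := dslope f 0
  set f2 := dslope f1 0
  set f3 := dslope f2 0
  set f4 := dslope f3 0
  refine ⟨f1 0, f2 0, f3 0, f4, fun z => ?_, fun z hz => (b4 z hz).trans_eq ?_⟩
  · have e1 := sub_smul_dslope f 0 z
    have e2 := sub_smul_dslope f1 0 z
    have e3 := sub_smul_dslope f2 0 z
    have e4 := sub_smul_dslope f3 0 z
    simp only [sub_zero, smul_eq_mul] at e1 e2 e3 e4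
    rw [hf0, sub_zero] at e1
    linear_combination -e1 - z * e2 - z ^ 2 * e3 - z ^ 3 * e4
  · field_simp
    ring

lemma norm_le_of_forall_sphere {E : ℂ → ℂ} (hE : Differentiable ℂ E) {R M : ℝ} (hR : 0 < R)
    (hM : ∀ z : ℂ, ‖z‖ = R → ‖E z‖ ≤ M) {z : ℂ} (hz : ‖z‖ ≤ R) : ‖E z‖ ≤ M := by
  refine Complex.norm_le_of_forall_mem_frontier_norm_le (U := Metric.ball 0 R)
    Metric.isBounded_ball hE.diffContOnCl (fun w hw => hM w ?_) ?_
  · rwa [frontier_ball 0 hR.ne', mem_sphere_zero_iff_norm] at hw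
  · rw [closure_ball 0 hR.ne']; simpa using hz

/-- An even entire function without zeros in a disk is, on the real axis near the origin,
controlled by its second-order expansion. -/
lemma log_norm_le_of_ne_zero {E : ℂ → ℂ} (hE : Differentiable ℂ E) (h0 : E 0 = 1)
    (heven : ∀ z, E (-z) = E z) {R L c D : ℝ} (hR : 0 < R) (hL : 0 < L)
    (hM : ∀ z : ℂ, ‖z‖ < R → ‖E z‖ ≤ Real.exp L) (hne : ∀ z : ℂ, ‖z‖ < R → E z ≠ 0)
    (hc : ∀ᶠ x : ℝ in nhdsWithin 0 (Set.Ioi 0), Real.log ‖E x‖ ≤ c * x ^ 2 + D * x ^ 4)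
    {x : ℝ} (hx : |x| ≤ R / 2) :
    Real.log ‖E x‖ ≤ c * x ^ 2 + 512 * L / R ^ 4 * x ^ 4 := by
  obtain ⟨g, hg, hg0, hgE⟩ := exists_log_on_ball (c := 0) (w := 0) hR hE.differentiableOn
    (fun z hz => hne z (by simpa using hz)) (by simp [h0])
  have hre : ∀ z : ℂ, ‖z‖ < R → (g z).re = Real.log ‖E z‖ := by
    intro z hz
    rw [← hgE z (by simpa using hz), Complex.norm_exp, Real.log_exp]
  have hB : ∀ z ∈ Metric.closedBall (0 : ℂ) (R / 2), ‖g z‖ ≤ 2 * L := by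
    intro z hz
    have hz' : ‖z‖ ≤ R / 2 := by simpa using hz
    have := Complex.borelCaratheodory_zero hL hg (fun w hw => ?_) hR (z := z)
      (by simp; linarith) hg0
    · refine this.trans ?_
      rw [div_le_iff₀ (by linarith)]
      nlinarith
    · have hw' : ‖w‖ < R := by simpa using hw
      show (g w).re ≤ L
      rw [hre w hw', Real.log_le_iff_le_exp (norm_pos_iff.2 (hne w hw'))]
      exact hM w hw'
  obtain ⟨p₁, p₂, p₃, r, hexp, hr⟩ :=
    exists_taylor_four (half_pos hR) (half_lt_self hR) hg hB hg0
  set K : ℝ := 512 * L / R ^ 4 with hK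
  have hK' : 16 * (2 * L) / (R / 2) ^ 4 = K := by rw [hK]; field_simp; norm_num
  have key : ∀ x : ℝ, |x| ≤ R / 2 → |Real.log ‖E x‖ - p₂.re * x ^ 2| ≤ K * x ^ 4 := by
    intro x hx
    have hxn : ‖(x : ℂ)‖ ≤ R / 2 := by simpa using hx
    have hxn' : ‖-(x : ℂ)‖ ≤ R / 2 := by simpa using hx
    have e1 := hre x (by linarith)
    have e2 := hre (-x) (by linarith)
    rw [heven] at e2
    have e3 : g x + g (-x) = 2 * p₂ * (x ^ 2 : ℝ) + (x ^ 4 : ℝ) * (r x + r (-x)) := by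
      rw [hexp x, hexp (-x)]; push_cast; ring
    have e4 := congrArg Complex.re e3
    rw [Complex.add_re, e1, e2, Complex.add_re, Complex.re_mul_ofReal, Complex.re_ofReal_mul,
      Complex.add_re] at e4
    have e5 : (2 * p₂).re = 2 * p₂.re := by simp
    rw [e5] at e4
    have b1 := (Complex.abs_re_le_norm _).trans (hr x (by simpa using hx))
    have b2 := (Complex.abs_re_le_norm _).trans (hr (-x) (by simpa using hx))
    rw [hK'] at b1 b2
    have e6 : Real.log ‖E x‖ - p₂.re * x ^ 2 = x ^ 4 * (((r x).re + (r (-x)).re) / 2) := by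
      linarith
    rw [e6, abs_mul, abs_of_nonneg (by positivity : (0 : ℝ) ≤ x ^ 4), mul_comm K]
    gcongr
    rw [abs_le] at *
    constructor <;> linarith [b1.1, b1.2, b2.1, b2.2]
  have hp : p₂.re ≤ c := by
    have hlim : Filter.Tendsto (fun x : ℝ => c + (D + K) * x ^ 2)
        (nhdsWithin 0 (Set.Ioi 0)) (nhds (c + (D + K) * 0 ^ 2)) := by
      refine Filter.Tendsto.mono_left ?_ nhdsWithin_le_nhds
      exact Continuous.tendsto (by fun_prop) 0
    have : p₂.re ≤ c + (D + K) * 0 ^ 2 := by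
      refine ge_of_tendsto hlim ?_
      filter_upwards [hc, self_mem_nhdsWithin,
        mem_nhdsWithin_of_mem_nhds (Iio_mem_nhds (half_pos hR))] with y hy hy0 hyR
      have hy0' : 0 < y := hy0
      have hyR' : y < R / 2 := hyR
      have := (abs_le.1 (key y (by rw [abs_of_pos hy0']; exact hyR'.le))).1
      have h3 : p₂.re * y ^ 2 ≤ (c + (D + K) * y ^ 2) * y ^ 2 := by nlinarith
      exact le_of_mul_le_mul_right h3 (by positivity)
    simpa using this
  have := (abs_le.1 (key x hx)).2
  nlinarith [mul_le_mul_of_nonneg_right hp (sq_nonneg x)]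

lemma differentiable_dslope {f : ℂ → ℂ} (a : ℂ) (hf : Differentiable ℂ f) :
    Differentiable ℂ (dslope f a) := by
  rw [← differentiableOn_univ] at hf ⊢
  exact (Complex.differentiableOn_dslope Filter.univ_mem).2 hf

/-- An even entire function with a purely imaginary zero factors through `1 + z ^ 2 / t ^ 2`. -/
lemma exists_factor_of_imaginary_zero {E : ℂ → ℂ} (hE : Differentiable ℂ E)
    (h0 : E 0 = 1) (heven : ∀ z, E (-z) = E z) {t : ℝ} (ht : E (t * Complex.I) = 0) :
    t ≠ 0 ∧ ∃ h : ℂ → ℂ, Differentiable ℂ h ∧ h 0 = 1 ∧ (∀ z, h (-z) = h z) ∧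
      ∀ z, E z = (1 + z ^ 2 / t ^ 2) * h z := by
  have ht0 : t ≠ 0 := by
    rintro rfl
    simp [h0] at ht
  have htc : (t : ℂ) ≠ 0 := by exact_mod_cast ht0
  set w : ℂ := t * Complex.I with hw
  have hw0 : w ≠ 0 := mul_ne_zero htc Complex.I_ne_zero
  set E1 := dslope E w with hE1
  set E2 := dslope E1 (-w) with hE2
  have d1 : Differentiable ℂ E1 := differentiable_dslope _ hE
  have d2 : Differentiable ℂ E2 := differentiable_dslope _ d1
  have e1 : ∀ z, E z = (z - w) * E1 z := by
    intro z
    have := sub_smul_dslope E w z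
    rw [ht, sub_zero] at this
    exact this.symm
  have hz1 : E1 (-w) = 0 := by
    have := e1 (-w)
    rw [heven, ht] at this
    have h2 : -w - w ≠ 0 := by
      intro h
      apply hw0
      linear_combination (-1 / 2 : ℂ) * h
    exact (mul_eq_zero.1 this.symm).resolve_left h2
  have e2 : ∀ z, E1 z = (z + w) * E2 z := by
    intro z
    have := sub_smul_dslope E1 (-w) z
    rw [hz1, sub_zero, sub_neg_eq_add] at this
    exact this.symm
  have hw2 : w ^ 2 = -t ^ 2 := by rw [hw, mul_pow, Complex.I_sq]; ring
  have e3 : ∀ z, E z = (1 + z ^ 2 / t ^ 2) * (t ^ 2 * E2 z) := by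
    intro z
    rw [e1, e2]
    field_simp
    linear_combination (-E2 z) * hw2
  have hdense : Dense {z : ℂ | 1 + z ^ 2 / (t : ℂ) ^ 2 ≠ 0} := by
    have : {z : ℂ | 1 + z ^ 2 / (t : ℂ) ^ 2 ≠ 0} = ({w, -w} : Set ℂ)ᶜ := by
      ext z
      simp only [Set.mem_ofPred_eq, Set.mem_compl_iff, Set.mem_insert_iff, Set.mem_singleton_iff,
        ne_eq, not_iff_not]
      rw [← sq_eq_sq_iff_eq_or_eq_neg, hw2]
      constructor
      · intro h
        field_simp at h
        linear_combination h
      · intro h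
        rw [h]
        field_simp
        ring
    rw [this]
    exact (Set.toFinite ({w, -w} : Set ℂ)).countable.dense_compl ℝ
  refine ⟨ht0, fun z => t ^ 2 * E2 z, by fun_prop, ?_, ?_, e3⟩
  · have := e3 0
    simpa [h0] using this.symm
  · have hcont : (fun z => (t : ℂ) ^ 2 * E2 (-z)) = fun z => (t : ℂ) ^ 2 * E2 z := by
      refine Continuous.ext_on hdense (by have := d2.continuous; fun_prop)
        (by have := d2.continuous; fun_prop) ?_
      intro z hz
      have h1 := e3 (-z)
      rw [heven, e3 z, neg_sq] at h1
      exact (mul_left_cancel₀ hz h1).symm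
    exact fun z => congrFun hcont z

/-- A finite version of the Hadamard factorization bound: an even entire function with purely
imaginary zeros is bounded on the real axis by its second-order expansion at `0`, up to an error
governed by its maximum modulus on a larger circle. -/
lemma log_norm_le_of_imaginary_zeros {R L : ℝ} (hR : 0 < R) (hL : 0 < L) (n : ℕ) :
    ∀ (E : ℂ → ℂ), Differentiable ℂ E → E 0 = 1 → (∀ z, E (-z) = E z) →
    (∀ z, E z = 0 → z.re = 0) →
    ∀ (M : ℝ), (∀ z : ℂ, ‖z‖ = 3 * R → ‖E z‖ ≤ M) → M < 8 ^ n → M ≤ Real.exp L →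
    ∀ c D : ℝ,
    (∀ᶠ x : ℝ in nhdsWithin 0 (Set.Ioi 0), Real.log ‖E x‖ ≤ c * x ^ 2 + D * x ^ 4) →
    ∀ x : ℝ, 0 < x → x ≤ R / 2 →
    Real.log ‖E x‖ ≤ c * x ^ 2 + 512 * L / R ^ 4 * x ^ 4 := by
  have h3R : 0 < 3 * R := by positivity
  induction n with
  | zero =>
    intro E hE h0 _ _ M hM hM1 _
    have := norm_le_of_forall_sphere hE h3R hM (z := 0) (by simpa using h3R.le)
    rw [h0] at this
    norm_num at this hM1
    linarith
  | succ n ih =>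
    intro E hE h0 heven hz M hM hMn hML c D hc x hx0 hx
    by_cases hne : ∀ z : ℂ, ‖z‖ < R → E z ≠ 0
    · refine log_norm_le_of_ne_zero hE h0 heven hR hL (fun z hz => ?_) hne hc
        (by rwa [abs_of_pos hx0])
      exact (norm_le_of_forall_sphere hE h3R hM (by linarith)).trans hML
    · push Not at hne
      obtain ⟨w, hwR, hw⟩ := hne
      have hwt : w = (w.im : ℝ) * Complex.I := by
        apply Complex.ext <;> simp [hz w hw]
      set t := w.im with ht
      obtain ⟨ht0, h, hd, hh0, hheven, hfac⟩ :=
        exists_factor_of_imaginary_zero hE h0 heven (t := t) (by rw [← hwt, hw])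
      have htR : |t| < R := (Complex.abs_im_le_norm w).trans_lt hwR
      have ht2 : 0 < t ^ 2 := by positivity
      have htR2 : t ^ 2 < R ^ 2 := by
        rw [← sq_abs]; gcongr
      have hM0 : 0 ≤ M := (norm_nonneg _).trans (hM (3 * R : ℝ) (by
        rw [Complex.norm_real, Real.norm_of_nonneg h3R.le]))
      have hlog : ∀ y : ℝ, Real.log ‖E y‖ = Real.log (1 + y ^ 2 / t ^ 2) + Real.log ‖h y‖ := by
        intro y
        have hyp : 0 < 1 + y ^ 2 / t ^ 2 := by positivity
        have e1 : ‖E y‖ = (1 + y ^ 2 / t ^ 2) * ‖h y‖ := by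
          rw [hfac, norm_mul]
          congr 1
          rw [← Real.norm_of_nonneg hyp.le, ← Complex.norm_real]
          push_cast
          rfl
        by_cases hy : ‖h y‖ = 0
        · exfalso
          have : E y = 0 := by rw [← norm_eq_zero, e1, hy, mul_zero]
          have h2 := hz _ this
          rw [Complex.ofReal_re] at h2
          rw [h2] at hy
          simp [hh0] at hy
        · rw [e1, Real.log_mul hyp.ne' hy]
      have hstep := ih h hd hh0 hheven
        (fun z hz' => hz z (by rw [hfac, hz', mul_zero])) (M / 8) (fun z hz' => ?_) ?_ ?_
        (c - 1 / t ^ 2) (D + 1 / t ^ 4) ?_ x hx0 hx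
      · rw [hlog]
        have h1 := Real.log_le_sub_one_of_pos (by positivity : 0 < 1 + x ^ 2 / t ^ 2)
        have h2 : (c - 1 / t ^ 2) * x ^ 2 = c * x ^ 2 - x ^ 2 / t ^ 2 := by ring
        linarith
      · have h1 := hM z hz'
        rw [hfac, norm_mul] at h1
        have h2 : 8 ≤ ‖1 + z ^ 2 / (t : ℂ) ^ 2‖ := by
          have e1 : ‖z ^ 2 / (t : ℂ) ^ 2‖ = 9 * R ^ 2 / t ^ 2 := by
            rw [norm_div, norm_pow, norm_pow, hz', Complex.norm_real, Real.norm_eq_abs, sq_abs]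
            ring
          have e2 : 9 ≤ 9 * R ^ 2 / t ^ 2 := by
            rw [le_div_iff₀ ht2]; linarith
          have e3 := norm_sub_norm_le (z ^ 2 / (t : ℂ) ^ 2) (-1)
          rw [e1, norm_neg, norm_one, sub_neg_eq_add, add_comm (z ^ 2 / (t : ℂ) ^ 2)] at e3
          linarith
        rw [le_div_iff₀ (by norm_num)]
        nlinarith [norm_nonneg (h z)]
      · rw [pow_succ] at hMn
        linarith
      · linarith
      · filter_upwards [hc] with y hy
        rw [hlog] at hy
        have hyp : 0 < 1 + y ^ 2 / t ^ 2 := by positivity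
        have h1 := Real.one_sub_inv_le_log_of_pos hyp
        have h2 : y ^ 2 / t ^ 2 - (y ^ 2 / t ^ 2) ^ 2 ≤ 1 - (1 + y ^ 2 / t ^ 2)⁻¹ := by
          set s := y ^ 2 / t ^ 2
          have hs : 0 ≤ s := by positivity
          have : (1 + s)⁻¹ ≤ 1 - s + s ^ 2 := by
            rw [inv_le_iff_one_le_mul₀ hyp]
            nlinarith [pow_nonneg hs 3]
          linarith
        have h3 : (c - 1 / t ^ 2) * y ^ 2 + (D + 1 / t ^ 4) * y ^ 4
            = c * y ^ 2 + D * y ^ 4 - (y ^ 2 / t ^ 2 - (y ^ 2 / t ^ 2) ^ 2) := by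
          field_simp
          ring
        linarith

/-- Near `0` an even entire function with value `1` at `0` has logarithm of order `x ^ 2`. -/
lemma exists_log_norm_le_near_zero {E : ℂ → ℂ} (hE : Differentiable ℂ E) (h0 : E 0 = 1)
    (heven : ∀ z, E (-z) = E z) :
    ∃ c : ℝ, ∀ᶠ x : ℝ in nhdsWithin 0 (Set.Ioi 0), Real.log ‖E x‖ ≤ c * x ^ 2 := by
  have d1 := differentiable_dslope 0 hE
  have d2 := differentiable_dslope 0 d1
  set E1 := dslope E 0 with hE1
  set E2 := dslope E1 0 with hE2
  have e1 : ∀ z, E z - 1 = z * E1 z := fun z => by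
    have := sub_smul_dslope E 0 z
    rw [h0, sub_zero] at this
    exact this.symm
  have e2 : ∀ z, E1 z - E1 0 = z * E2 z := fun z => by
    have := sub_smul_dslope E1 0 z
    rw [sub_zero] at this
    exact this.symm
  have hodd : (fun z => E1 (-z)) = fun z => -E1 z := by
    refine Continuous.ext_on (dense_compl_singleton (0 : ℂ)) (by have := d1.continuous; fun_prop)
      (by have := d1.continuous; fun_prop) ?_
    intro z hz
    have h1 := e1 (-z)
    rw [heven, e1 z] at h1
    have : z * (E1 (-z) + E1 z) = 0 := by linear_combination h1
    exact eq_neg_of_add_eq_zero_left ((mul_eq_zero.1 this).resolve_left hz)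
  have h10 : E1 0 = 0 := by
    have := congrFun hodd 0
    simp only [neg_zero] at this
    linear_combination (1 / 2 : ℂ) * this
  have hcont : Continuous fun x : ℝ => ‖E2 x‖ := by
    have := d2.continuous
    fun_prop
  have hE0 : Filter.Tendsto (fun x : ℝ => ‖E x‖) (nhds 0) (nhds 1) := by
    have h := hE.continuous
    have : Continuous fun x : ℝ => ‖E x‖ := by fun_prop
    simpa [h0] using this.tendsto 0
  refine ⟨‖E2 0‖ + 1, Filter.Eventually.filter_mono nhdsWithin_le_nhds ?_⟩
  have hlt : ∀ᶠ x : ℝ in nhds 0, ‖E2 x‖ < ‖E2 0‖ + 1 := by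
    have := hcont.tendsto 0
    simp only [Complex.ofReal_zero] at this
    exact this.eventually_lt_const (by linarith)
  filter_upwards [hlt, hE0.eventually_const_lt (by norm_num : (0 : ℝ) < 1)] with x hx hx0
  have h1 : E x = 1 + (x ^ 2 : ℝ) * E2 x := by
    have a1 := e1 x
    have a2 := e2 x
    push_cast
    linear_combination a1 + x * a2 + x * h10
  have h2 : ‖E x‖ ≤ 1 + x ^ 2 * ‖E2 x‖ := by
    rw [h1]
    refine (norm_add_le _ _).trans ?_
    rw [norm_one, norm_mul, Complex.norm_real, Real.norm_of_nonneg (sq_nonneg x)]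
  have h3 := Real.log_le_sub_one_of_pos hx0
  nlinarith [mul_le_mul_of_nonneg_left hx.le (sq_nonneg x)]

/-- On a disk tangent to the imaginary axis, a function obeying the ridge property and free of
zeros in the right half-plane has a logarithm, real on the real axis, obeying the ridge bound. -/
lemma exists_real_log_of_ridge {E : ℂ → ℂ} (hE : Differentiable ℂ E)
    (hridge : ∀ z : ℂ, ‖E z‖ ≤ ‖E z.re‖) (hzero : ∀ z, E z = 0 → z.re = 0)
    {ρ : ℝ} (hρ : 0 < ρ) :
    ∃ G : ℂ → ℂ, DifferentiableOn ℂ G (Metric.ball (ρ : ℂ) ρ) ∧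
      (∀ x : ℝ, (x : ℂ) ∈ Metric.ball (ρ : ℂ) ρ → G x = (Real.log ‖E x‖ : ℝ)) ∧
      ∀ z ∈ Metric.ball (ρ : ℂ) ρ, (G z).re ≤ Real.log ‖E z.re‖ := by
  have hpos : ∀ z ∈ Metric.ball (ρ : ℂ) ρ, 0 < z.re := by
    intro z hz
    rw [mem_ball_iff_norm] at hz
    have := (abs_lt.1 ((Complex.abs_re_le_norm _).trans_lt hz)).1
    simp at this
    exact this
  have hne : ∀ z ∈ Metric.ball (ρ : ℂ) ρ, E z ≠ 0 :=
    fun z hz h => (hpos z hz).ne' (hzero z h)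
  have hconj : ∀ z ∈ Metric.ball (ρ : ℂ) ρ, starRingEnd ℂ z ∈ Metric.ball (ρ : ℂ) ρ := by
    intro z hz
    rw [mem_ball_iff_norm] at hz ⊢
    rw [← Complex.conj_ofReal ρ, ← map_sub, Complex.norm_conj]
    exact hz
  obtain ⟨g, hg, -, hgE⟩ := exists_log_on_ball (w := Complex.log (E ρ)) hρ hE.differentiableOn hne
    (Complex.exp_log (hne _ (Metric.mem_ball_self hρ)))
  have hre : ∀ z ∈ Metric.ball (ρ : ℂ) ρ, (g z).re = Real.log ‖E z‖ := by
    intro z hz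
    rw [← hgE z hz, Complex.norm_exp, Real.log_exp]
  refine ⟨fun z => (g z + starRingEnd ℂ (g (starRingEnd ℂ z))) / 2, ?_, ?_, ?_⟩
  · refine DifferentiableOn.div_const (hg.add ?_) 2
    intro z hz
    refine DifferentiableAt.differentiableWithinAt ?_
    have h1 := hg.differentiableAt (Metric.isOpen_ball.mem_nhds (hconj z hz))
    have h2 := h1.hasDerivAt.conj_conj
    rw [Complex.conj_conj] at h2
    exact h2.differentiableAt
  · intro x hx
    simp only [Complex.conj_ofReal]
    rw [Complex.add_conj, ← hre x hx]
    push_cast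
    ring
  · intro z hz
    have e1 : ((g z + starRingEnd ℂ (g (starRingEnd ℂ z))) / 2).re
        = ((g z).re + (g (starRingEnd ℂ z)).re) / 2 := by
      rw [← Complex.ofReal_ofNat, Complex.div_ofReal_re]; simp
    rw [e1, hre z hz, hre _ (hconj z hz)]
    have a1 := Real.log_le_log (norm_pos_iff.2 (hne z hz)) (hridge z)
    have a2 := Real.log_le_log (norm_pos_iff.2 (hne _ (hconj z hz))) (hridge _)
    rw [Complex.conj_re] at a2
    linarith

/-- The point of modulus `r` and argument `y`, relative to the disk of center and radius
`r / cos θ`. -/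
lemma norm_cos_mul_exp_sub_one_le {θ y : ℝ} (hy0 : 0 ≤ y) (hyθ : y ≤ θ) (hθ : θ < Real.pi / 2) :
    ‖(Real.cos θ : ℂ) * Complex.exp (y * Complex.I) - 1‖ ≤ Real.sin θ := by
  have hs : 0 ≤ Real.sin θ := Real.sin_nonneg_of_nonneg_of_le_pi (by linarith) (by linarith)
  have hc : 0 < Real.cos θ := Real.cos_pos_of_mem_Ioo ⟨by linarith, hθ⟩
  have hcc : Real.cos θ ≤ Real.cos y := Real.cos_le_cos_of_nonneg_of_le_pi hy0 (by linarith) hyθ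
  rw [← abs_of_nonneg hs, ← abs_of_nonneg (norm_nonneg _), ← sq_le_sq, ← Complex.normSq_eq_norm_sq,
    Complex.normSq_apply]
  have e1 : ((Real.cos θ : ℂ) * Complex.exp (y * Complex.I) - 1).re
      = Real.cos θ * Real.cos y - 1 := by
    rw [Complex.sub_re, Complex.re_ofReal_mul, Complex.exp_ofReal_mul_I_re, Complex.one_re]
  have e2 : ((Real.cos θ : ℂ) * Complex.exp (y * Complex.I) - 1).im
      = Real.cos θ * Real.sin y := by
    rw [Complex.sub_im, Complex.im_ofReal_mul, Complex.exp_ofReal_mul_I_im, Complex.one_im,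
      sub_zero]
  rw [e1, e2]
  nlinarith [Real.sin_sq_add_cos_sq θ, Real.sin_sq_add_cos_sq y,
    mul_le_mul_of_nonneg_left hcc hc.le]

lemma norm_le_of_ridge_log {φ : ℝ → ℝ} {G : ℂ → ℂ} {ρ r θ y : ℝ}
    (hφ0 : ∀ x, 0 ≤ φ x) (hmono : ∀ x y, 0 ≤ x → x ≤ y → φ x ≤ φ y)
    (hG : DifferentiableOn ℂ G (Metric.ball (ρ : ℂ) ρ))
    (hGx : ∀ x : ℝ, (x : ℂ) ∈ Metric.ball (ρ : ℂ) ρ → G x = (φ x : ℝ))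
    (hGre : ∀ z ∈ Metric.ball (ρ : ℂ) ρ, (G z).re ≤ φ z.re)
    (hy0 : 0 ≤ y) (hyθ : y ≤ θ) (hθ : θ < Real.pi / 2) (hr : 0 < r) (hrρ : r / Real.cos θ ≤ ρ) :
    ‖G (r * Complex.exp (y * Complex.I))‖ ≤
      (1 + 2 * Real.sin θ / (1 - Real.sin θ)) * (φ (2 * r / Real.cos θ) + 1) := by
  have hc : 0 < Real.cos θ := Real.cos_pos_of_mem_Ioo ⟨by linarith, hθ⟩
  have hs : 0 ≤ Real.sin θ := Real.sin_nonneg_of_nonneg_of_le_pi (by linarith) (by linarith)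
  have hs1 : Real.sin θ < 1 := by nlinarith [Real.sin_sq_add_cos_sq θ]
  set q : ℝ := r / Real.cos θ with hq
  have hq0 : 0 < q := by positivity
  have h2q : 2 * r / Real.cos θ = 2 * q := by rw [hq]; ring
  rw [h2q]
  have hmaps : ∀ ζ : ℂ, ‖ζ‖ < 1 → (q : ℂ) * (1 + ζ) ∈ Metric.ball (ρ : ℂ) ρ := by
    intro ζ hζ
    rw [mem_ball_iff_norm]
    have e : (q : ℂ) * (1 + ζ) - ρ = q * ζ + ((q - ρ : ℝ) : ℂ) := by push_cast; ring
    rw [e]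
    refine (norm_add_le _ _).trans_lt ?_
    rw [norm_mul, Complex.norm_real, Complex.norm_real, Real.norm_of_nonneg hq0.le,
      Real.norm_of_nonpos (by linarith)]
    nlinarith
  set M : ℝ := φ (2 * q) + 1 with hM
  have hM0 : 0 < M := by have := hφ0 (2 * q); linarith
  have hGq : G q = (φ q : ℝ) := hGx q (by simpa using hmaps 0 (by simp))
  set f : ℂ → ℂ := fun ζ => G (q * (1 + ζ)) - (φ q : ℝ) with hf
  have hfd : DifferentiableOn ℂ f (Metric.ball 0 1) := by
    refine DifferentiableOn.sub_const ?_ _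
    exact hG.comp (t := Metric.ball (ρ : ℂ) ρ) (Differentiable.differentiableOn (by fun_prop))
      (fun ζ hζ => hmaps ζ (by simpa using hζ))
  have hfM : Set.MapsTo f (Metric.ball 0 1) {z | z.re ≤ M} := by
    intro ζ hζ
    have hζ' : ‖ζ‖ < 1 := by simpa using hζ
    have hζr := abs_lt.1 ((Complex.abs_re_le_norm ζ).trans_lt hζ')
    have h1 := hGre _ (hmaps ζ hζ')
    have e : ((q : ℂ) * (1 + ζ)).re = q * (1 + ζ.re) := by simp
    rw [e] at h1
    have h2 := hmono (q * (1 + ζ.re)) (2 * q) (by nlinarith) (by nlinarith)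
    have h3 := hφ0 q
    show (G (q * (1 + ζ)) - (φ q : ℝ)).re ≤ M
    rw [Complex.sub_re, Complex.ofReal_re]
    linarith
  set ζ : ℂ := (Real.cos θ : ℂ) * Complex.exp (y * Complex.I) - 1 with hζ
  have hζs : ‖ζ‖ ≤ Real.sin θ := norm_cos_mul_exp_sub_one_le hy0 hyθ hθ
  have hbc := Complex.borelCaratheodory_zero hM0 hfd hfM one_pos (z := ζ)
    (by simpa using hζs.trans_lt hs1) (by simp [hf, hGq])
  have e1 : (q : ℂ) * (1 + ζ) = r * Complex.exp (y * Complex.I) := by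
    rw [hζ, hq]
    have : (Real.cos θ : ℂ) ≠ 0 := by exact_mod_cast hc.ne'
    push_cast at this ⊢
    field_simp
    ring
  have e2 : G (r * Complex.exp (y * Complex.I)) = f ζ + (φ q : ℝ) := by
    rw [← e1, hf]; ring
  rw [e2]
  refine (norm_add_le _ _).trans ?_
  rw [Complex.norm_real, Real.norm_of_nonneg (hφ0 q)]
  have h4 := hmono q (2 * q) hq0.le (by linarith)
  have h5 : 2 * M * ‖ζ‖ / (1 - ‖ζ‖) ≤ 2 * M * Real.sin θ / (1 - Real.sin θ) := by
    have : 0 < 1 - Real.sin θ := by linarith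
    gcongr
  have h6 : (1 + 2 * Real.sin θ / (1 - Real.sin θ)) * M
    = M + 2 * M * Real.sin θ / (1 - Real.sin θ) := by ring
  linarith

lemma cos_half_div_le_re {θ a : ℝ} (hθ0 : 0 < θ) (hθ : θ < Real.pi / 2) (ha : 0 ≤ a) :
    Real.cos (θ / 2) / (1 + a) ≤
      (Complex.exp (-(θ / 2 : ℝ) * Complex.I) / (1 + a * Complex.exp (-θ * Complex.I))).re := by
  have hc : 0 < Real.cos (θ / 2) := Real.cos_pos_of_mem_Ioo ⟨by linarith, by linarith⟩
  set D : ℂ := Complex.exp ((θ / 2 : ℝ) * Complex.I)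
    + a * Complex.exp ((-(θ / 2) : ℝ) * Complex.I) with hD
  have hDre : D.re = (1 + a) * Real.cos (θ / 2) := by
    rw [hD, Complex.add_re, Complex.re_ofReal_mul, Complex.exp_ofReal_mul_I_re,
      Complex.exp_ofReal_mul_I_re, Real.cos_neg]
    ring
  have hDpos : 0 < D.re := by rw [hDre]; positivity
  have hD0 : D ≠ 0 := fun h => by simp [h] at hDpos
  have hDn : ‖D‖ ≤ 1 + a := by
    refine (norm_add_le _ _).trans_eq ?_
    rw [norm_mul, Complex.norm_exp_ofReal_mul_I, Complex.norm_exp_ofReal_mul_I, Complex.norm_real,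
      Real.norm_of_nonneg ha]
    ring
  have e1 : Complex.exp (-(θ / 2 : ℝ) * Complex.I) / (1 + a * Complex.exp (-θ * Complex.I))
      = D⁻¹ := by
    have h1 : Complex.exp (-(θ / 2 : ℝ) * Complex.I) * D
        = 1 + a * Complex.exp (-θ * Complex.I) := by
      rw [hD, mul_add, ← Complex.exp_add, mul_left_comm, ← Complex.exp_add]
      congr 1
      · rw [← Complex.exp_zero]; congr 1; ring
      · congr 2; push_cast; ring
    rw [← h1]
    field_simp
  rw [e1, Complex.inv_re, hDre, Complex.normSq_eq_norm_sq,
    div_le_div_iff₀ (by positivity) (by positivity)]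
  have h2 : ‖D‖ ^ 2 ≤ (1 + a) ^ 2 := by gcongr
  nlinarith [mul_le_mul_of_nonneg_left h2 hc.le]

lemma le_of_map_mul_le {φ : ℝ → ℝ} (hφ0 : ∀ x, 0 ≤ φ x)
    (hconv : ∀ c x, 0 ≤ c → c ≤ 1 → 0 ≤ x → φ (c * x) ≤ c * φ x) {x y : ℝ} (hx : 0 ≤ x)
    (hxy : x ≤ y) : φ x ≤ φ y := by
  rcases (hx.trans hxy).eq_or_lt with hy | hy
  · rw [show x = y by linarith]
  · have h1 := hconv (x / y) y (by positivity) (by rwa [div_le_one hy]) hy.le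
    rw [div_mul_cancel₀ _ hy.ne'] at h1
    exact h1.trans (mul_le_of_le_one_left (hφ0 y) (by rwa [div_le_one hy]))

lemma one_le_re_one_add_mul_exp {η : ℝ} (hη : 0 ≤ η) {u : ℂ} (hu : |u.im| ≤ Real.pi / 2) :
    1 ≤ (1 + η * Complex.exp u).re := by
  rw [Complex.add_re, Complex.re_ofReal_mul, Complex.exp_re, Complex.one_re]
  have := Real.cos_nonneg_of_mem_Icc (abs_le.1 hu)
  have : 0 ≤ η * (Real.exp u.re * Real.cos u.im) := by positivity
  linarith

/-- Integrating the logarithm against a power weight around the boundary of a sector, whose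
opening is chosen so that the two sides contribute with different signs. -/
lemma integral_le_of_ridge_log {φ : ℝ → ℝ} {G : ℂ → ℂ} {ρ θ η L K : ℝ} {n : ℕ} (hn : 4 ≤ n)
    (hθ : (n + 1 / 2) * θ = 2 * Real.pi) (hη : 0 < η) (hL : 0 ≤ L)
    (hφ0 : ∀ x, 0 ≤ φ x) (hφc : Continuous φ)
    (hconv : ∀ c x, 0 ≤ c → c ≤ 1 → 0 ≤ x → φ (c * x) ≤ c * φ x)
    (hG : DifferentiableOn ℂ G (Metric.ball (ρ : ℂ) ρ))
    (hGx : ∀ x : ℝ, (x : ℂ) ∈ Metric.ball (ρ : ℂ) ρ → G x = (φ x : ℝ))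
    (hGre : ∀ z ∈ Metric.ball (ρ : ℂ) ρ, (G z).re ≤ φ z.re)
    (hK : 1 + 2 * Real.sin θ / (1 - Real.sin θ) = K)
    (hρ : Real.exp L / Real.cos θ ≤ ρ) :
    (Real.cos (θ / 2) - Real.cos θ) *
        ∫ t in (0 : ℝ)..L, φ (Real.exp t) * (Real.exp (-n * t) / (1 + η * Real.exp t)) ≤
      K * (φ (2 / Real.cos θ) + 1) * θ +
        K * (φ (2 * Real.exp L / Real.cos θ) + 1) * (Real.exp (-n * L) / (η * Real.exp L)) * θ := by
  have hn' : (4 : ℝ) ≤ n := by exact_mod_cast hn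
  have hpi := Real.pi_pos
  have hθ0 : 0 < θ := by
    by_contra! h
    nlinarith
  have hθ2 : θ < Real.pi / 2 := by
    by_contra! h
    nlinarith
  have hc : 0 < Real.cos θ := Real.cos_pos_of_mem_Ioo ⟨by linarith, hθ2⟩
  have hc1 : Real.cos θ ≤ 1 := Real.cos_le_one θ
  have hmono : ∀ x y, 0 ≤ x → x ≤ y → φ x ≤ φ y := fun _ _ => le_of_map_mul_le hφ0 hconv
  have hball : ∀ s : ℂ, s.re ≤ L → 0 ≤ s.im → s.im ≤ θ →
      Complex.exp s ∈ Metric.ball (ρ : ℂ) ρ := by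
    intro s hs h0 h1
    have hcos := Real.cos_le_cos_of_nonneg_of_le_pi h0 (by linarith) h1
    have he : Real.exp s.re ≤ ρ * Real.cos θ := by
      rw [div_le_iff₀ hc] at hρ
      exact (Real.exp_le_exp.2 hs).trans hρ
    have hep := Real.exp_pos s.re
    have hρ0 : 0 < ρ := by
      by_contra! h
      nlinarith
    rw [mem_ball_iff_norm, ← abs_of_pos hρ0, ← abs_of_nonneg (norm_nonneg _), ← sq_lt_sq,
      ← Complex.normSq_eq_norm_sq, Complex.normSq_apply, Complex.sub_re, Complex.sub_im,
      Complex.exp_re, Complex.exp_im, Complex.ofReal_re, Complex.ofReal_im, abs_of_pos hρ0]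
    have h2 := mul_le_mul_of_nonneg_left hcos hρ0.le
    have h3 : 0 < Real.exp s.re * (2 * (ρ * Real.cos s.im) - Real.exp s.re) :=
      mul_pos hep (by linarith)
    linear_combination h3 + Real.exp s.re ^ 2 * Real.sin_sq_add_cos_sq s.im
  have hden : ∀ s : ℂ, 0 ≤ s.im → s.im ≤ θ → 1 ≤ (1 + η * Complex.exp (s - θ * Complex.I)).re := by
    intro s h0 h1
    refine one_le_re_one_add_mul_exp hη.le ?_
    rw [abs_le]
    simp
    constructor <;> linarith
  have hden0 : ∀ s : ℂ, 0 ≤ s.im → s.im ≤ θ → 1 + η * Complex.exp (s - θ * Complex.I) ≠ 0 := by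
    intro s h0 h1 h
    have := hden s h0 h1
    rw [h] at this
    norm_num at this
  set H : ℂ → ℂ := fun s => G (Complex.exp s) *
    (Complex.exp (-n * (s - θ * Complex.I)) / (1 + η * Complex.exp (s - θ * Complex.I))) with hH
  have hHd : DifferentiableOn ℂ H (Set.uIcc (0 : ℂ).re (L + θ * Complex.I : ℂ).re ×ℂ
      Set.uIcc (0 : ℂ).im (L + θ * Complex.I : ℂ).im) := by
    have hmem : ∀ s ∈ (Set.uIcc (0 : ℂ).re (L + θ * Complex.I : ℂ).re ×ℂ
      Set.uIcc (0 : ℂ).im (L + θ * Complex.I : ℂ).im), s.re ≤ L ∧ 0 ≤ s.im ∧ s.im ≤ θ := by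
      intro s hs
      rw [Complex.mem_reProdIm] at hs
      simp only [Complex.zero_re, Complex.add_re, Complex.ofReal_re, Complex.mul_re, Complex.I_re,
        mul_zero, Complex.ofReal_im, Complex.I_im, mul_one, sub_self, add_zero, Complex.zero_im,
        Complex.add_im, Complex.mul_im, zero_add, Set.uIcc_of_le hL, Set.uIcc_of_le hθ0.le] at hs
      exact ⟨hs.1.2, hs.2.1, hs.2.2⟩
    refine DifferentiableOn.mul ?_ (DifferentiableOn.div (by fun_prop) (by fun_prop) ?_)
    · exact hG.comp Complex.differentiable_exp.differentiableOn
        (fun s hs => hball s (hmem s hs).1 (hmem s hs).2.1 (hmem s hs).2.2)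
    · exact fun s hs => hden0 s (hmem s hs).2.1 (hmem s hs).2.2
  have hcauchy := Complex.integral_boundary_rect_eq_zero_of_differentiableOn H 0
    (L + θ * Complex.I) hHd
  have hHc : ContinuousOn H (Set.Icc 0 L ×ℂ Set.Icc 0 θ) := by
    have := hHd.continuousOn
    simpa [Set.uIcc_of_le hL, Set.uIcc_of_le hθ0.le] using this
  simp only [Complex.zero_re, Complex.add_re, Complex.ofReal_re, Complex.mul_re, Complex.I_re,
    mul_zero, Complex.ofReal_im, Complex.I_im, mul_one, sub_self, add_zero, Complex.zero_im,
    Complex.add_im, Complex.mul_im, zero_add, Complex.ofReal_zero, zero_mul] at hcauchy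
  set w : ℝ → ℝ := fun t => Real.exp (-n * t) / (1 + η * Real.exp t) with hw
  have hw0 : ∀ t, 0 ≤ w t := fun t => by positivity
  have hwc : Continuous w := by
    refine Continuous.div (by fun_prop) (by fun_prop) (fun t => ?_)
    positivity
  have hint : ∀ y ∈ Set.Icc 0 θ, ContinuousOn (fun t : ℝ => H (t + y * Complex.I))
      (Set.Icc 0 L) := by
    intro y hy
    refine hHc.comp (by fun_prop) (fun t ht => ?_)
    rw [Complex.mem_reProdIm]
    simpa using ⟨ht, hy⟩
  have hI0 : IntervalIntegrable (fun t : ℝ => H t) volume 0 L := by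
    refine ContinuousOn.intervalIntegrable_of_Icc hL ?_
    simpa using hint 0 ⟨le_rfl, hθ0.le⟩
  have hIθ : IntervalIntegrable (fun t : ℝ => H (t + θ * Complex.I)) volume 0 L :=
    ContinuousOn.intervalIntegrable_of_Icc hL (hint θ ⟨hθ0.le, le_rfl⟩)
  have hIre : ∀ {f : ℝ → ℂ}, IntervalIntegrable f volume 0 L →
      IntervalIntegrable (fun t => Complex.reCLM (f t)) volume 0 L :=
    fun hf => ⟨Complex.reCLM.integrable_comp hf.1, Complex.reCLM.integrable_comp hf.2⟩
  have hIφ : ∀ k : ℝ, IntervalIntegrable (fun t => k * (φ (Real.exp t) * w t)) volume 0 L :=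
    fun k => Continuous.intervalIntegrable (by fun_prop) _ _
  have hbot : Real.cos (θ / 2) * ∫ t in (0 : ℝ)..L, φ (Real.exp t) * w t
      ≤ (∫ t in (0 : ℝ)..L, H t).re := by
    rw [← Complex.reCLM_apply, ← Complex.reCLM.intervalIntegral_comp_comm hI0,
      ← intervalIntegral.integral_const_mul]
    refine intervalIntegral.integral_mono_on hL (hIφ _)
      (hIre hI0) (fun t ht => ?_)
    rw [Complex.reCLM_apply]
    have e1 : H t = ((φ (Real.exp t) * Real.exp (-n * t) : ℝ) : ℂ) *
        (Complex.exp (-(θ / 2 : ℝ) * Complex.I) /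
          (1 + (η * Real.exp t : ℝ) * Complex.exp (-θ * Complex.I))) := by
      have hb := hball t (by simpa using ht.2) (by simp) (by simpa using hθ0.le)
      rw [← Complex.ofReal_exp] at hb
      have e2 : Complex.exp (-n * (t - θ * Complex.I))
          = Complex.exp ((-n * t : ℝ)) * Complex.exp (-(θ / 2 : ℝ) * Complex.I) := by
        rw [← Complex.exp_add, Complex.exp_eq_exp_iff_exists_int]
        refine ⟨1, ?_⟩
        have := congrArg (fun x : ℝ => (x : ℂ)) hθ
        push_cast at this ⊢
        linear_combination Complex.I * this
      have e3 : Complex.exp (t - θ * Complex.I)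
          = Complex.exp (t : ℝ) * Complex.exp (-θ * Complex.I) := by
        rw [← Complex.exp_add]; congr 1; ring
      simp only [hH]
      rw [e2, e3, ← Complex.ofReal_exp, hGx _ hb]
      push_cast
      ring
    rw [e1, Complex.re_ofReal_mul]
    have h1 := cos_half_div_le_re hθ0 hθ2 (a := η * Real.exp t) (by positivity)
    have h2 : 0 ≤ φ (Real.exp t) * Real.exp (-n * t) := mul_nonneg (hφ0 _) (Real.exp_pos _).le
    refine le_trans (le_of_eq ?_) (mul_le_mul_of_nonneg_left h1 h2)
    simp only [hw]
    ring
  have htop : (∫ t in (0 : ℝ)..L, H (t + θ * Complex.I)).re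
      ≤ Real.cos θ * ∫ t in (0 : ℝ)..L, φ (Real.exp t) * w t := by
    rw [← Complex.reCLM_apply, ← Complex.reCLM.intervalIntegral_comp_comm hIθ,
      ← intervalIntegral.integral_const_mul]
    refine intervalIntegral.integral_mono_on hL
      (hIre hIθ) (hIφ _) (fun t ht => ?_)
    rw [Complex.reCLM_apply]
    have e1 : H (t + θ * Complex.I) = G (Complex.exp (t + θ * Complex.I)) * (w t : ℝ) := by
      simp only [hH, hw, add_sub_cancel_right]
      push_cast
      ring
    rw [e1, Complex.re_mul_ofReal]
    have hb := hball (t + θ * Complex.I) (by simpa using ht.2) (by simpa using hθ0.le) (by simp)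
    have h1 := hGre _ hb
    have h2 : (Complex.exp (t + θ * Complex.I)).re = Real.cos θ * Real.exp t := by
      rw [Complex.exp_re]; simp; ring
    rw [h2] at h1
    have h3 := hconv (Real.cos θ) (Real.exp t) hc.le hc1 (Real.exp_pos t).le
    calc _ ≤ (Real.cos θ * φ (Real.exp t)) * w t :=
          mul_le_mul_of_nonneg_right (h1.trans h3) (hw0 t)
      _ = _ := by ring
  have harc : ∀ u : ℝ, u ≤ L → ∀ y ∈ Set.uIoc 0 θ,
      ‖G (Complex.exp (u + y * Complex.I))‖ ≤ K * (φ (2 * Real.exp u / Real.cos θ) + 1) := by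
    intro u hu y hy
    rw [Set.uIoc_of_le hθ0.le] at hy
    rw [Complex.exp_add, ← Complex.ofReal_exp, ← hK]
    refine norm_le_of_ridge_log hφ0 hmono hG hGx hGre hy.1.le hy.2 hθ2 (Real.exp_pos u) ?_
    refine le_trans ?_ hρ
    gcongr
  have hK0 : 0 ≤ K := by
    have hs : 0 ≤ Real.sin θ := Real.sin_nonneg_of_nonneg_of_le_pi hθ0.le (by linarith)
    have hs1 : 0 ≤ 1 - Real.sin θ := by linarith [Real.sin_le_one θ]
    rw [← hK]
    positivity
  have hWn : ∀ u y : ℝ, ‖Complex.exp (-n * (u + y * Complex.I - θ * Complex.I))‖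
      = Real.exp (-n * u) := by
    intro u y
    rw [Complex.norm_exp]
    simp
  have hin : ‖∫ y in (0 : ℝ)..θ, H (y * Complex.I)‖ ≤ K * (φ (2 / Real.cos θ) + 1) * θ := by
    refine (intervalIntegral.norm_integral_le_of_norm_le_const
      (C := K * (φ (2 / Real.cos θ) + 1)) (fun y hy => ?_)).trans_eq (by
        rw [sub_zero, abs_of_pos hθ0])
    have h1 := harc 0 hL y hy
    have h2 := hWn 0 y
    simp only [Complex.ofReal_zero, zero_add, Real.exp_zero, mul_one, mul_zero] at h1 h2
    simp only [hH]
    rw [norm_mul, norm_div, h2]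
    rw [Set.uIoc_of_le hθ0.le] at hy
    have h3 := (hden (y * Complex.I) (by simpa using hy.1.le) (by simpa using hy.2)).trans
      (Complex.re_le_norm _)
    refine (mul_le_of_le_one_right (norm_nonneg _) ?_).trans h1
    rw [div_le_one (by linarith)]
    exact h3
  have hout : ‖∫ y in (0 : ℝ)..θ, H (L + y * Complex.I)‖ ≤
      K * (φ (2 * Real.exp L / Real.cos θ) + 1) *
        (Real.exp (-n * L) / (η * Real.exp L)) * θ := by
    refine (intervalIntegral.norm_integral_le_of_norm_le_const
      (C := K * (φ (2 * Real.exp L / Real.cos θ) + 1) *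
        (Real.exp (-n * L) / (η * Real.exp L))) (fun y hy => ?_)).trans_eq (by
        rw [sub_zero, abs_of_pos hθ0])
    have h1 := harc L le_rfl y hy
    simp only [hH]
    rw [norm_mul, norm_div, hWn]
    rw [Set.uIoc_of_le hθ0.le] at hy
    refine mul_le_mul h1 ?_ (by positivity)
      (mul_nonneg hK0 (by linarith [hφ0 (2 * Real.exp L / Real.cos θ)]))
    refine div_le_div_of_nonneg_left (Real.exp_pos _).le (by positivity) ?_
    set v : ℂ := η * Complex.exp (L + y * Complex.I - θ * Complex.I) with hv
    have hvn : ‖v‖ = η * Real.exp L := by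
      rw [hv, norm_mul, Complex.norm_real, Real.norm_of_nonneg hη.le, Complex.norm_exp]
      simp
    have hvr : 0 ≤ v.re := by
      have := hden (L + y * Complex.I) (by simpa using hy.1.le) (by simpa using hy.2)
      rw [← hv, Complex.add_re, Complex.one_re] at this
      linarith
    rw [← hvn, ← abs_of_nonneg (norm_nonneg v), ← abs_of_nonneg (norm_nonneg (1 + v)), ← sq_le_sq,
      ← Complex.normSq_eq_norm_sq, ← Complex.normSq_eq_norm_sq, Complex.normSq_apply,
      Complex.normSq_apply]
    simp only [Complex.add_re, Complex.one_re, Complex.add_im, Complex.one_im, zero_add]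
    nlinarith
  set A := ∫ t in (0 : ℝ)..L, H t
  set B := ∫ t in (0 : ℝ)..L, H (t + θ * Complex.I)
  set C := ∫ y in (0 : ℝ)..θ, H (L + y * Complex.I)
  set D := ∫ y in (0 : ℝ)..θ, H (y * Complex.I)
  have hAB : A - B = Complex.I * (D - C) := by
    simp only [smul_eq_mul] at hcauchy
    linear_combination hcauchy
  have hfin : A.re - B.re ≤ ‖D‖ + ‖C‖ := by
    rw [← Complex.sub_re, hAB]
    refine (Complex.re_le_norm _).trans ?_
    rw [norm_mul, Complex.norm_I, one_mul]
    exact norm_sub_le _ _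
  linarith

/-- A nonnegative function with finite weighted mean is infinitely often small against the
weight. -/
lemma exists_le_mul_exp_of_integral_le {φ : ℝ → ℝ} {m C : ℝ} (hφ0 : ∀ x, 0 ≤ φ x)
    (hφc : Continuous φ)
    (hS : ∀ L : ℝ, 0 ≤ L → ∫ t in (0 : ℝ)..L, φ (Real.exp t) * Real.exp (-m * t) ≤ C)
    {K ε : ℝ} (hK : 0 < K) (hε : 0 < ε) (T : ℝ) :
    ∃ L, T ≤ L ∧ φ (K * Real.exp L) ≤ ε * Real.exp (m * L) := by
  by_contra! h
  set k := Real.log K with hk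
  set T₁ := max 0 (T + k) with hT₁
  set δ := ε * Real.exp (-m * k) with hδ
  have hδ0 : 0 < δ := by positivity
  have hint : ∀ a b : ℝ, IntervalIntegrable (fun t => φ (Real.exp t) * Real.exp (-m * t))
      volume a b := fun a b => Continuous.intervalIntegrable (by fun_prop) _ _
  have hlow : ∀ t, T₁ ≤ t → δ ≤ φ (Real.exp t) * Real.exp (-m * t) := by
    intro t ht
    have h1 := h (t - k) (by linarith [le_max_right 0 (T + k)])
    have e1 : K * Real.exp (t - k) = Real.exp t := by
      rw [← Real.exp_log hK, ← Real.exp_add]; congr 1; ring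
    rw [e1] at h1
    have e2 : δ = ε * Real.exp (m * (t - k)) * Real.exp (-m * t) := by
      rw [hδ, mul_assoc, ← Real.exp_add]; congr 2; ring
    rw [e2]
    exact mul_le_mul_of_nonneg_right h1.le (Real.exp_pos _).le
  set L := T₁ + (|C| + 1) / δ with hL
  have hTL : T₁ ≤ L := by
    have : 0 ≤ (|C| + 1) / δ := by positivity
    linarith
  have hT0 : 0 ≤ T₁ := le_max_left _ _
  have h1 := hS L (hT0.trans hTL)
  rw [← intervalIntegral.integral_add_adjacent_intervals (hint 0 T₁) (hint T₁ L)] at h1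
  have h2 : 0 ≤ ∫ t in (0 : ℝ)..T₁, φ (Real.exp t) * Real.exp (-m * t) :=
    intervalIntegral.integral_nonneg hT0 (fun t _ => mul_nonneg (hφ0 _) (Real.exp_pos _).le)
  have h3 : ∫ _ in T₁..L, δ ≤ ∫ t in T₁..L, φ (Real.exp t) * Real.exp (-m * t) :=
    intervalIntegral.integral_mono_on hTL (by simp) (hint _ _) (fun t ht => hlow t ht.1)
  have h4 : ∫ _ in T₁..L, δ = |C| + 1 := by
    rw [intervalIntegral.integral_const, smul_eq_mul, hL]
    field_simp
    ring
  linarith [le_abs_self C]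

/-- Lowering the exponent in an integral growth bound by one. -/
lemma exists_integral_le_of_succ {φ : ℝ → ℝ} (hφ0 : ∀ x, 0 ≤ φ x) (hφc : Continuous φ)
    (hconv : ∀ c x, 0 ≤ c → c ≤ 1 → 0 ≤ x → φ (c * x) ≤ c * φ x)
    (hlog : ∀ ρ : ℝ, 0 < ρ → ∃ G : ℂ → ℂ, DifferentiableOn ℂ G (Metric.ball (ρ : ℂ) ρ) ∧
      (∀ x : ℝ, (x : ℂ) ∈ Metric.ball (ρ : ℂ) ρ → G x = (φ x : ℝ)) ∧
      ∀ z ∈ Metric.ball (ρ : ℂ) ρ, (G z).re ≤ φ z.re)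
    {n : ℕ} (hn : 4 ≤ n)
    (hS : ∃ C, ∀ L : ℝ, 0 ≤ L →
      ∫ t in (0 : ℝ)..L, φ (Real.exp t) * Real.exp (-((n + 1 : ℕ) : ℝ) * t) ≤ C) :
    ∃ C, ∀ L : ℝ, 0 ≤ L → ∫ t in (0 : ℝ)..L, φ (Real.exp t) * Real.exp (-(n : ℝ) * t) ≤ C := by
  obtain ⟨C₀, hC₀⟩ := hS
  have hn' : (4 : ℝ) ≤ n := by exact_mod_cast hn
  have hpi := Real.pi_pos
  set θ : ℝ := 2 * Real.pi / (n + 1 / 2) with hθdef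
  have hθ : (n + 1 / 2) * θ = 2 * Real.pi := by rw [hθdef]; field_simp
  have hθ0 : 0 < θ := by positivity
  have hθ2 : θ < Real.pi / 2 := by
    by_contra! h
    nlinarith
  have hc : 0 < Real.cos θ := Real.cos_pos_of_mem_Ioo ⟨by linarith, hθ2⟩
  have hcos : 0 < Real.cos (θ / 2) - Real.cos θ :=
    sub_pos.2 (Real.cos_lt_cos_of_nonneg_of_le_pi (by linarith) (by linarith) (by linarith))
  set K : ℝ := 1 + 2 * Real.sin θ / (1 - Real.sin θ) with hK
  have hK0 : 0 ≤ K := by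
    have hs : 0 ≤ Real.sin θ := Real.sin_nonneg_of_nonneg_of_le_pi hθ0.le (by linarith)
    have hs1 : 0 ≤ 1 - Real.sin θ := by linarith [Real.sin_le_one θ]
    positivity
  set B : ℝ := K * (φ (2 / Real.cos θ) + 1) * θ + 2 * K * θ with hB
  refine ⟨2 * (B / (Real.cos (θ / 2) - Real.cos θ)), fun L₀ hL₀ => ?_⟩
  obtain ⟨L, hLL, hL⟩ := exists_le_mul_exp_of_integral_le hφ0 hφc hC₀
    (K := 2 / Real.cos θ) (ε := Real.exp (-L₀)) (by positivity) (Real.exp_pos _) L₀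
  have hL0 : 0 ≤ L := hL₀.trans hLL
  obtain ⟨G, hG, hGx, hGre⟩ := hlog (Real.exp L / Real.cos θ) (by positivity)
  have hmain := integral_le_of_ridge_log hn hθ (Real.exp_pos (-L₀)) hL0 hφ0 hφc hconv hG hGx hGre
    hK.symm le_rfl
  set w : ℝ → ℝ := fun t => Real.exp (-n * t) / (1 + Real.exp (-L₀) * Real.exp t) with hw
  have hw0 : ∀ t, 0 ≤ w t := fun t => by positivity
  have hwc : Continuous w := by
    refine Continuous.div (by fun_prop) (by fun_prop) (fun t => ?_)
    positivity
  have hint : ∀ a b : ℝ, IntervalIntegrable (fun t => φ (Real.exp t) * w t) volume a b :=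
    fun a b => Continuous.intervalIntegrable (by fun_prop) _ _
  have hout : (φ (2 * Real.exp L / Real.cos θ) + 1) *
      (Real.exp (-n * L) / (Real.exp (-L₀) * Real.exp L)) ≤ 2 := by
    have e1 : 2 * Real.exp L / Real.cos θ = 2 / Real.cos θ * Real.exp L := by ring
    have e2 : Real.exp (-n * L) / (Real.exp (-L₀) * Real.exp L)
        = Real.exp (L₀ - (n + 1) * L) := by
      rw [← Real.exp_add, ← Real.exp_sub]; congr 1; ring
    rw [e1, e2]
    have e3 : Real.exp (-L₀) * Real.exp (((n + 1 : ℕ) : ℝ) * L) * Real.exp (L₀ - (n + 1) * L)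
        = 1 := by
      rw [← Real.exp_add, ← Real.exp_add, Real.exp_eq_one_iff]; push_cast; ring
    have e4 : Real.exp (L₀ - (n + 1) * L) ≤ 1 := Real.exp_le_one_iff.2 (by nlinarith)
    have := mul_le_mul_of_nonneg_right hL (Real.exp_pos (L₀ - (n + 1) * L)).le
    linarith
  have hmain' : (Real.cos (θ / 2) - Real.cos θ) * ∫ t in (0 : ℝ)..L, φ (Real.exp t) * w t ≤ B := by
    refine hmain.trans ?_
    rw [hB]
    have := mul_le_mul_of_nonneg_left hout (mul_nonneg hK0 hθ0.le)
    linarith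
  rw [← le_div_iff₀' hcos] at hmain'
  have h1 : ∫ t in (0 : ℝ)..L₀, φ (Real.exp t) * w t ≤ ∫ t in (0 : ℝ)..L, φ (Real.exp t) * w t :=
    intervalIntegral.integral_mono_interval le_rfl hL₀ hLL
      (Filter.Eventually.of_forall fun t => mul_nonneg (hφ0 _) (hw0 t)) (hint _ _)
  have h2 : ∫ t in (0 : ℝ)..L₀, φ (Real.exp t) * Real.exp (-(n : ℝ) * t)
      ≤ ∫ t in (0 : ℝ)..L₀, 2 * (φ (Real.exp t) * w t) := by
    refine intervalIntegral.integral_mono_on hL₀ (Continuous.intervalIntegrable (by fun_prop) _ _)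
      (Continuous.intervalIntegrable (by fun_prop) _ _) (fun t ht => ?_)
    rw [mul_left_comm]
    refine mul_le_mul_of_nonneg_left ?_ (hφ0 _)
    rw [hw, mul_div_assoc', le_div_iff₀ (by positivity)]
    have h3 : Real.exp (-L₀) * Real.exp t ≤ 1 := by
      rw [← Real.exp_add]
      exact Real.exp_le_one_iff.2 (by linarith [ht.2])
    nlinarith [Real.exp_pos (-(n : ℝ) * t)]
  rw [intervalIntegral.integral_const_mul] at h2
  linarith

/-- An even entire function with the ridge property, finite order and purely imaginary zeros has
Gaussian growth on the real axis. -/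
theorem exists_norm_le_exp_sq {E : ℂ → ℂ} (hE : Differentiable ℂ E) (h0 : E 0 = 1)
    (heven : ∀ z, E (-z) = E z) (hridge : ∀ z : ℂ, ‖E z‖ ≤ ‖E z.re‖)
    (hzero : ∀ z, E z = 0 → z.re = 0) (hpos : ∀ x : ℝ, 1 ≤ ‖E x‖)
    (hconv : ∀ c x : ℝ, 0 ≤ c → c ≤ 1 → 0 ≤ x →
      Real.log ‖E (c * x : ℝ)‖ ≤ c * Real.log ‖E x‖)
    (hgrowth : ∃ (C : ℝ) (N : ℕ), ∀ x : ℝ, 1 ≤ x → Real.log ‖E x‖ ≤ C * x ^ N) :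
    ∃ c : ℝ, ∀ x : ℝ, 0 < x → ‖E x‖ ≤ Real.exp (c * x ^ 2) := by
  set φ : ℝ → ℝ := fun x => Real.log ‖E x‖ with hφ
  have hφ0 : ∀ x, 0 ≤ φ x := fun x => Real.log_nonneg (hpos x)
  have hEp : ∀ x : ℝ, 0 < ‖E x‖ := fun x => by linarith [hpos x]
  have hφc : Continuous φ := by
    have := hE.continuous
    exact Continuous.log (by fun_prop) (fun x => (hEp x).ne')
  have hmono : ∀ x y, 0 ≤ x → x ≤ y → φ x ≤ φ y := fun _ _ => le_of_map_mul_le hφ0 hconv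
  have hlog := fun (ρ : ℝ) (hρ : 0 < ρ) => exists_real_log_of_ridge hE hridge hzero hρ
  have hS : ∃ C, ∀ L : ℝ, 0 ≤ L →
      ∫ t in (0 : ℝ)..L, φ (Real.exp t) * Real.exp (-((4 : ℕ) : ℝ) * t) ≤ C := by
    obtain ⟨C, N, hCN⟩ := hgrowth
    have hstart : ∃ C, ∀ L : ℝ, 0 ≤ L →
        ∫ t in (0 : ℝ)..L, φ (Real.exp t) * Real.exp (-((4 + N : ℕ) : ℝ) * t) ≤ C := by
      have hC : 0 ≤ C := by simpa using (hφ0 1).trans (hCN 1 le_rfl)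
      refine ⟨C, fun L hL => ?_⟩
      have h1 : ∫ t in (0 : ℝ)..L, φ (Real.exp t) * Real.exp (-((4 + N : ℕ) : ℝ) * t)
          ≤ ∫ t in (0 : ℝ)..L, C * Real.exp (-t) := by
        refine intervalIntegral.integral_mono_on hL
          (Continuous.intervalIntegrable (by fun_prop) _ _)
          (Continuous.intervalIntegrable (by fun_prop) _ _) (fun t ht => ?_)
        have h2 := hCN (Real.exp t) (Real.one_le_exp ht.1)
        refine (mul_le_mul_of_nonneg_right h2 (Real.exp_pos _).le).trans ?_
        rw [mul_assoc, ← Real.exp_nat_mul, ← Real.exp_add]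
        refine mul_le_mul_of_nonneg_left (Real.exp_le_exp.2 ?_) hC
        push_cast
        linarith [ht.1]
      refine h1.trans ?_
      rw [intervalIntegral.integral_const_mul, intervalIntegral.integral_comp_neg
        (fun t => Real.exp t), integral_exp, neg_zero, Real.exp_zero]
      nlinarith [Real.exp_pos (-L)]
    have hdesc : ∀ k : ℕ, (∃ C, ∀ L : ℝ, 0 ≤ L →
        ∫ t in (0 : ℝ)..L, φ (Real.exp t) * Real.exp (-((4 + k : ℕ) : ℝ) * t) ≤ C) →
        ∃ C, ∀ L : ℝ, 0 ≤ L →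
          ∫ t in (0 : ℝ)..L, φ (Real.exp t) * Real.exp (-((4 : ℕ) : ℝ) * t) ≤ C := by
      intro k
      induction k with
      | zero => exact id
      | succ k ih =>
        exact fun h => ih (exists_integral_le_of_succ hφ0 hφc hconv hlog (by omega) h)
    exact hdesc N hstart
  obtain ⟨C, hC⟩ := hS
  obtain ⟨c, hc⟩ := exists_log_norm_le_near_zero hE h0 heven
  refine ⟨c, fun x hx => ?_⟩
  rw [← Real.log_le_iff_le_exp (hEp x)]
  refine le_of_forall_pos_le_add fun δ hδ => ?_
  set ε : ℝ := δ / (1024 * x ^ 4) with hε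
  have hε0 : 0 < ε := by positivity
  obtain ⟨l, hl, hlε⟩ := exists_le_mul_exp_of_integral_le hφ0 hφc hC (K := 3) (by norm_num) hε0
    (max (Real.log (2 * x)) (-Real.log ε / 4))
  set R := Real.exp l with hR
  have hR0 : 0 < R := Real.exp_pos l
  have hxR : x ≤ R / 2 := by
    have := (Real.log_le_iff_le_exp (by positivity)).1 ((le_max_left _ _).trans hl)
    linarith
  have hR4 : Real.exp (((4 : ℕ) : ℝ) * l) = R ^ 4 := Real.exp_nat_mul _ _
  have hεR : 1 ≤ ε * R ^ 4 := by
    have h1 := (le_max_right _ _).trans hl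
    rw [← hR4, ← Real.exp_log hε0, ← Real.exp_add]
    refine Real.one_le_exp ?_
    push_cast
    linarith
  rw [hR4] at hlε
  have hLpos : 0 < φ (3 * R) + 1 := by linarith [hφ0 (3 * R)]
  have hM : ∀ z : ℂ, ‖z‖ = 3 * R → ‖E z‖ ≤ Real.exp (φ (3 * R) + 1) := by
    intro z hz
    refine (hridge z).trans ?_
    have h1 : φ |z.re| ≤ φ (3 * R) :=
      hmono _ _ (abs_nonneg _) (hz ▸ Complex.abs_re_le_norm z)
    have h2 : ‖E (|z.re| : ℝ)‖ = ‖E z.re‖ := by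
      rcases abs_choice z.re with h | h
      · rw [h]
      · rw [h, Complex.ofReal_neg, heven]
    rw [← h2, ← Real.log_le_iff_le_exp (hEp _)]
    exact h1.trans (by linarith)
  obtain ⟨n, hn⟩ := pow_unbounded_of_one_lt (Real.exp (φ (3 * R) + 1)) (by norm_num : (1 : ℝ) < 8)
  have hfin := log_norm_le_of_imaginary_zeros hR0 hLpos n E hE h0 heven hzero _ hM hn le_rfl c 0
    (by simpa using hc) x hx hxR
  refine hfin.trans ?_
  have h5 : 512 * (φ (3 * R) + 1) / R ^ 4 * x ^ 4 ≤ δ := by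
    have h6 : φ (3 * R) + 1 ≤ 2 * ε * R ^ 4 := by linarith
    calc 512 * (φ (3 * R) + 1) / R ^ 4 * x ^ 4 ≤ 512 * (2 * ε * R ^ 4) / R ^ 4 * x ^ 4 := by
          gcongr
      _ = δ := by rw [hε]; field_simp; norm_num
  linarith

lemma mul_abs_le_rpow_add {a b x u : ℝ} (ha : 1 < a) (hb : 0 < b) (hx : 0 ≤ x) :
    x * |u| ≤ b * |u| ^ a + x * (x / b) ^ (1 / (a - 1)) := by
  have ha' : 0 < a - 1 := by linarith
  have hT : 0 ≤ (x / b) ^ (1 / (a - 1)) := by positivity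
  rcases le_total |u| ((x / b) ^ (1 / (a - 1))) with h | h
  · have h1 := mul_le_mul_of_nonneg_left h hx
    have h2 : 0 ≤ b * |u| ^ a := by positivity
    linarith
  · have h1 : x / b ≤ |u| ^ (a - 1) := by
      have := Real.rpow_le_rpow hT h ha'.le
      rwa [← Real.rpow_mul (by positivity), one_div_mul_cancel ha'.ne', Real.rpow_one] at this
    rw [div_le_iff₀ hb] at h1
    have h2 : |u| ^ a = |u| ^ (a - 1) * |u| := by
      rcases (abs_nonneg u).eq_or_lt with h0 | h0
      · rw [← h0, Real.zero_rpow (by linarith), mul_zero]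
      · rw [← Real.rpow_add_one h0.ne', sub_add_cancel]
    have h3 := mul_le_mul_of_nonneg_right h1 (abs_nonneg u)
    have h4 : 0 ≤ x * (x / b) ^ (1 / (a - 1)) := by positivity
    rw [h2]
    linarith

lemma integrable_exp_mul_and_mgf_le
    {Ω : Type*} [MeasurableSpace Ω] {P : Measure Ω} {X : Ω → ℝ}
    {a b : ℝ} (hX : Measurable X) (ha : 1 < a) (hb : 0 < b)
    (hint : Integrable (fun ω => Real.exp (b * |X ω| ^ a)) P) (x : ℝ) :
    Integrable (fun ω => Real.exp (x * X ω)) P ∧ ProbabilityTheory.mgf X P x ≤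
      Real.exp (|x| * (|x| / b) ^ (1 / (a - 1))) * ∫ ω, Real.exp (b * |X ω| ^ a) ∂P := by
  have hle : ∀ ω, Real.exp (x * X ω) ≤
      Real.exp (|x| * (|x| / b) ^ (1 / (a - 1))) * Real.exp (b * |X ω| ^ a) := by
    intro ω
    rw [← Real.exp_add, Real.exp_le_exp]
    have h1 := mul_abs_le_rpow_add (u := X ω) ha hb (abs_nonneg x)
    have h2 := le_abs_self (x * X ω)
    rw [abs_mul] at h2
    linarith
  have hI : Integrable (fun ω => Real.exp (x * X ω)) P := by
    refine (hint.const_mul (Real.exp (|x| * (|x| / b) ^ (1 / (a - 1))))).mono'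
      (by fun_prop) (Filter.Eventually.of_forall fun ω => ?_)
    rw [Real.norm_of_nonneg (Real.exp_pos _).le]
    exact hle ω
  refine ⟨hI, ?_⟩
  rw [← integral_const_mul]
  exact integral_mono hI (hint.const_mul _) hle

lemma mgf_mul_le_rpow
    {Ω : Type*} [MeasurableSpace Ω] {P : Measure Ω} [IsProbabilityMeasure P] {X : Ω → ℝ}
    (hI : ∀ x : ℝ, Integrable (fun ω => Real.exp (x * X ω)) P) {c : ℝ}
    (hc0 : 0 ≤ c) (hc1 : c ≤ 1) (x : ℝ) :
    ProbabilityTheory.mgf X P (c * x) ≤ ProbabilityTheory.mgf X P x ^ c := by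
  have e : ∀ ω, Real.exp (x * X ω) ^ c = Real.exp (c * x * X ω) := by
    intro ω
    rw [← Real.exp_mul]
    congr 1
    ring
  have h := (Real.concaveOn_rpow hc0 hc1).le_map_integral
    (Real.continuous_rpow_const hc0).continuousOn isClosed_Ici
    (Filter.Eventually.of_forall fun ω => (Real.exp_pos (x * X ω)).le) (hI x)
    ((hI (c * x)).congr (Filter.Eventually.of_forall fun ω => (e ω).symm))
  simp only [e] at h
  exact h

lemma exp_mul_integral_le_mgf
    {Ω : Type*} [MeasurableSpace Ω] {P : Measure Ω} [IsProbabilityMeasure P] {X : Ω → ℝ}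
    (hI : ∀ x : ℝ, Integrable (fun ω => Real.exp (x * X ω)) P)
    (hXI : Integrable X P) (x : ℝ) :
    Real.exp (x * ∫ ω, X ω ∂P) ≤ ProbabilityTheory.mgf X P x := by
  have h := convexOn_exp.map_integral_le Real.continuous_exp.continuousOn isClosed_univ
    (Filter.Eventually.of_forall fun ω => Set.mem_univ (x * X ω)) (hXI.const_mul x) (hI x)
  rw [integral_const_mul] at h
  exact h

/-- A Gaussian bound on the moment generating function gives Gaussian tails. -/
lemma integrable_exp_sq_of_mgf_le
    {Ω : Type*} [MeasurableSpace Ω] {P : Measure Ω} [IsProbabilityMeasure P] {X : Ω → ℝ}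
    {A c m : ℝ} (hX : Measurable X)
    (hI : ∀ x : ℝ, Integrable (fun ω => Real.exp (x * X ω)) P) (hA : 0 < A) (hcA : c + 1 ≤ A)
    (hM : ∀ x : ℝ, ProbabilityTheory.mgf X P x ≤ Real.exp (c * x ^ 2 + m * x)) :
    Integrable (fun ω => Real.exp (1 / (4 * A) * X ω ^ 2)) P := by
  set f : ℝ × Ω → ℝ := fun p => Real.exp (p.1 * X p.2 - A * p.1 ^ 2) with hf
  have hfac : ∀ x ω, f (x, ω) = Real.exp (-A * x ^ 2) * Real.exp (x * X ω) := by
    intro x ω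
    simp only [hf]
    rw [← Real.exp_add, Real.exp_eq_exp]
    ring
  have hfm : AEStronglyMeasurable f (volume.prod P) :=
    Measurable.aestronglyMeasurable (by fun_prop)
  have hfi : Integrable f (volume.prod P) := by
    rw [integrable_prod_iff hfm]
    refine ⟨Filter.Eventually.of_forall fun x => ?_, ?_⟩
    · simp only [hfac]
      exact (hI x).const_mul _
    · have h1 : Integrable (fun x : ℝ => Real.exp (m ^ 2 / 2) * Real.exp (-(1 / 2) * x ^ 2)) :=
        (integrable_exp_neg_mul_sq (by norm_num)).const_mul _
      refine h1.mono' hfm.norm.integral_prod_right' (Filter.Eventually.of_forall fun x => ?_)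
      have h2 : ∫ ω, ‖f (x, ω)‖ ∂P = Real.exp (-A * x ^ 2) * ProbabilityTheory.mgf X P x := by
        simp only [hfac, norm_mul, Real.norm_of_nonneg (Real.exp_pos _).le]
        exact integral_const_mul _ _
      rw [h2, Real.norm_of_nonneg (mul_nonneg (Real.exp_pos _).le ProbabilityTheory.mgf_nonneg)]
      refine (mul_le_mul_of_nonneg_left (hM x) (Real.exp_pos _).le).trans ?_
      rw [← Real.exp_add, ← Real.exp_add, Real.exp_le_exp]
      nlinarith [sq_nonneg (m - x), mul_le_mul_of_nonneg_right hcA (sq_nonneg x)]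
  have h3 := hfi.integral_prod_right
  have h4 : ∀ ω, ∫ x, f (x, ω) = Real.exp (1 / (4 * A) * X ω ^ 2) * √(Real.pi / A) := by
    intro ω
    rw [← integral_gaussian, ← integral_sub_right_eq_self (fun x => Real.exp (-A * x ^ 2))
      (X ω / (2 * A)), ← integral_const_mul]
    congr 1
    ext x
    simp only [hf]
    rw [← Real.exp_add, Real.exp_eq_exp]
    field_simp
    ring
  simp only [h4] at h3
  have h5 : √(Real.pi / A) ≠ 0 := by have := Real.pi_pos; positivity
  refine (h3.mul_const (√(Real.pi / A))⁻¹).congr (Filter.Eventually.of_forall fun ω => ?_)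
  simp only
  rw [mul_inv_cancel_right₀ h5]

/-- If a real random variable `X` satisfies `E[exp(b |X|^a)] < ∞` for some `b > 0`, `a > 1`,
but `E[exp(b' X²)] = ∞` for every `b' > 0` (tail strictly heavier than Gaussian), then the
entire function `z ↦ E[exp(z X)]` has a zero that is not purely imaginary. -/
theorem exists_non_imaginary_zero_of_slow_tail
    {Ω : Type*} [MeasurableSpace Ω] (P : Measure Ω) [IsProbabilityMeasure P]
    (X : Ω → ℝ) (hX : Measurable X)
    (a b : ℝ) (ha : 1 < a) (hb : 0 < b)
    (hint : Integrable (fun ω => Real.exp (b * |X ω| ^ a)) P)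
    (hinf : ∀ b' : ℝ, 0 < b' → ¬ Integrable (fun ω => Real.exp (b' * (X ω) ^ 2)) P) :
    ∃ z : ℂ, z.re ≠ 0 ∧ (∫ ω, Complex.exp (z * (X ω : ℂ)) ∂P) = 0 := by
  by_contra! hno
  set M : ℝ → ℝ := ProbabilityTheory.mgf X P with hMdef
  set F : ℂ → ℂ := ProbabilityTheory.complexMGF X P with hF
  set C₀ : ℝ := ∫ ω, Real.exp (b * |X ω| ^ a) ∂P with hC₀
  have hI : ∀ x : ℝ, Integrable (fun ω => Real.exp (x * X ω)) P :=
    fun x => (integrable_exp_mul_and_mgf_le hX ha hb hint x).1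
  have hMle : ∀ x : ℝ, M x ≤ Real.exp (|x| * (|x| / b) ^ (1 / (a - 1))) * C₀ :=
    fun x => (integrable_exp_mul_and_mgf_le hX ha hb hint x).2
  have huniv : ProbabilityTheory.integrableExpSet X P = Set.univ := Set.eq_univ_of_forall hI
  have hXI : Integrable X P :=
    ProbabilityTheory.integrable_of_mem_interior_integrableExpSet (by simp [huniv])
  have hFd : Differentiable ℂ F := by
    have := ProbabilityTheory.differentiableOn_complexMGF (X := X) (μ := P)
    rwa [huniv, interior_univ, show {z : ℂ | z.re ∈ Set.univ} = Set.univ by ext; simp,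
      differentiableOn_univ] at this
  have hMpos : ∀ x, 0 < M x := fun x => ProbabilityTheory.mgf_pos (hI x)
  have hMexp : ∀ x, Real.exp (x * ∫ ω, X ω ∂P) ≤ M x := exp_mul_integral_le_mgf hI hXI
  have hM0 : M 0 = 1 := by simp [hMdef]
  have hFx : ∀ x : ℝ, F x = M x := fun x => ProbabilityTheory.complexMGF_ofReal x
  set E : ℂ → ℂ := fun z => F z * F (-z) with hE
  have hEx : ∀ x : ℝ, ‖E x‖ = M x * M (-x) := by
    intro x
    have h1 : E x = ((M x * M (-x) : ℝ) : ℂ) := by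
      simp only [hE]
      rw [← Complex.ofReal_neg, hFx, hFx, Complex.ofReal_mul]
    rw [h1, Complex.norm_real, Real.norm_of_nonneg (mul_pos (hMpos _) (hMpos _)).le]
  have hlogE : ∀ x : ℝ, Real.log ‖E x‖ = Real.log (M x) + Real.log (M (-x)) := by
    intro x
    rw [hEx, Real.log_mul (hMpos _).ne' (hMpos _).ne']
  have hridge : ∀ z : ℂ, ‖E z‖ ≤ ‖E z.re‖ := by
    intro z
    rw [hEx, hE, norm_mul]
    have h2 : ‖F (-z)‖ ≤ M (-z).re := ProbabilityTheory.norm_complexMGF_le_mgf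
    exact mul_le_mul ProbabilityTheory.norm_complexMGF_le_mgf h2 (norm_nonneg _) (hMpos _).le
  have hF0 : ∀ z, F z = 0 → z.re = 0 := by
    intro z hz
    by_contra h
    exact hno z h hz
  have hzero : ∀ z, E z = 0 → z.re = 0 := by
    intro z hz
    rcases mul_eq_zero.1 hz with h | h
    · exact hF0 z h
    · simpa using hF0 _ h
  have hC₀1 : 1 ≤ C₀ := by
    have := hMle 0
    simpa [hM0] using this
  have hgrowth : ∃ (C : ℝ) (N : ℕ), ∀ x : ℝ, 1 ≤ x → Real.log ‖E x‖ ≤ C * x ^ N := by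
    obtain ⟨N, hN⟩ := exists_nat_ge (1 / (a - 1))
    set B : ℝ := (1 / b) ^ (1 / (a - 1)) with hB
    have hB0 : 0 ≤ B := by positivity
    refine ⟨2 * (B + Real.log C₀), N + 1, fun x hx => ?_⟩
    have hx0 : 0 < x := by linarith
    have hl0 : 0 ≤ Real.log C₀ := Real.log_nonneg hC₀1
    have hpow : x * (x / b) ^ (1 / (a - 1)) ≤ B * x ^ (N + 1) := by
      have h1 : (x / b) ^ (1 / (a - 1)) = B * x ^ (1 / (a - 1)) := by
        rw [hB, ← Real.mul_rpow (by positivity) hx0.le]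
        congr 1
        ring
      have h2 : x ^ (1 / (a - 1)) ≤ x ^ N := by
        rw [← Real.rpow_natCast]
        exact Real.rpow_le_rpow_of_exponent_le hx hN
      rw [h1, pow_succ]
      nlinarith [mul_le_mul_of_nonneg_left h2 (mul_nonneg hB0 hx0.le)]
    have hlog : ∀ y : ℝ, |y| = x → Real.log (M y) ≤ B * x ^ (N + 1) + Real.log C₀ := by
      intro y hy
      have h1 := Real.log_le_log (hMpos y) (hMle y)
      rw [Real.log_mul (Real.exp_ne_zero _) (by linarith), Real.log_exp, hy] at h1
      linarith
    have h1 := hlog x (abs_of_pos hx0)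
    have h2 := hlog (-x) (by rw [abs_neg, abs_of_pos hx0])
    have h3 : Real.log C₀ ≤ Real.log C₀ * x ^ (N + 1) :=
      le_mul_of_one_le_right hl0 (one_le_pow₀ hx)
    rw [hlogE]
    linarith
  have hconv : ∀ c x : ℝ, 0 ≤ c → c ≤ 1 → 0 ≤ x →
      Real.log ‖E (c * x : ℝ)‖ ≤ c * Real.log ‖E x‖ := by
    have hlog : ∀ c x : ℝ, 0 ≤ c → c ≤ 1 → Real.log (M (c * x)) ≤ c * Real.log (M x) := by
      intro c x hc0 hc1
      rw [← Real.log_rpow (hMpos x)]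
      exact Real.log_le_log (hMpos _) (mgf_mul_le_rpow hI hc0 hc1 x)
    intro c x hc0 hc1 _
    have h1 := hlog c x hc0 hc1
    have h2 := hlog c (-x) hc0 hc1
    rw [mul_neg] at h2
    rw [hlogE, hlogE]
    linarith
  have hpos : ∀ x : ℝ, 1 ≤ ‖E x‖ := by
    intro x
    rw [hEx]
    have h1 := mul_le_mul (hMexp x) (hMexp (-x)) (Real.exp_pos _).le (hMpos _).le
    rwa [← Real.exp_add, neg_mul, add_neg_cancel, Real.exp_zero] at h1
  obtain ⟨c, hc⟩ := exists_norm_le_exp_sq (E := E) (by fun_prop)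
    (by
      have := hFx 0
      rw [Complex.ofReal_zero, hM0] at this
      simp [hE, this])
    (fun z => by simp only [hE, neg_neg]; ring) hridge hzero hpos hconv hgrowth
  set m : ℝ := ∫ ω, X ω ∂P
  have hbound : ∀ x : ℝ, M x ≤ Real.exp (c * x ^ 2 + m * x) := by
    intro x
    have hprod : M x * M (-x) ≤ Real.exp (c * x ^ 2) := by
      rcases lt_trichotomy x 0 with h | h | h
      · have := hc (-x) (by linarith)
        rw [hEx, neg_neg, neg_sq] at this
        linarith
      · simp [h, hM0]
      · exact hEx x ▸ hc x h
    have h1 : M x * Real.exp (-x * m) ≤ Real.exp (c * x ^ 2) :=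
      (mul_le_mul_of_nonneg_left (hMexp (-x)) (hMpos x).le).trans hprod
    have h2 := mul_le_mul_of_nonneg_right h1 (Real.exp_pos (x * m)).le
    rw [mul_assoc, ← Real.exp_add, ← Real.exp_add, neg_mul, neg_add_cancel, Real.exp_zero,
      mul_one] at h2
    rwa [mul_comm m]
  have hA : 0 < |c| + 1 := by positivity
  exact hinf (1 / (4 * (|c| + 1))) (by positivity)
    (integrable_exp_sq_of_mgf_le hX hI hA (by linarith [le_abs_self c]) hbound)
end

section
/- Suppose X is a real random variable of Lee–Yang type, and let f(z) = E[exp(z X)]. Then there exist B ≥ 0 and a summable sequence (a_k)_{k∈ℕ} of nonnegative real numbers such that f(z) = e^{B z²} ∏_{k} (1 + a_k z²) for all z ∈ ℂ, and moreover E[X²] = Var[X] = 2·(B + Σ_k a_k). -/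
open MeasureTheory

/-- A real random variable `X` (on a probability space `(Ω, P)`) is of Lee–Yang type if
(1) `X` and `-X` have the same distribution, (2) `E[exp(b X²)] < ∞` for some `b > 0`, and
(3) the moment generating function `z ↦ E[exp(z X)]` is nonzero whenever `Re z ≠ 0`. -/
def IsLeeYangRV {Ω : Type*} [MeasurableSpace Ω] (P : Measure Ω) (X : Ω → ℝ) : Prop :=
  P.map (fun ω => -(X ω)) = P.map X ∧
  (∃ b : ℝ, 0 < b ∧ Integrable (fun ω => Real.exp (b * (X ω) ^ 2)) P) ∧
  (∀ z : ℂ, z.re ≠ 0 → (∫ ω, Complex.exp (z * (X ω : ℂ)) ∂P) ≠ 0)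

/-- A nonvanishing holomorphic function on a disc, normalized at the centre, is there the
exponential of its linear part up to a quadratic error. -/
theorem exists_eq_exp_deriv_mul_add {g : ℂ → ℂ} (hg : Differentiable ℂ g) (h0 : g 0 = 1)
    {R M : ℝ} (hR : 0 < R) (hM : 0 < M) (hz : ∀ z, ‖z‖ < R → g z ≠ 0)
    (hb : ∀ z, ‖z‖ < R → ‖g z‖ ≤ Real.exp M) {w : ℂ} (hw : ‖w‖ ≤ R / 16) :
    ∃ e : ℂ, g w = Complex.exp (deriv g 0 * w + e) ∧ ‖e‖ ≤ 64 * M / R ^ 2 * ‖w‖ ^ 2 := by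
  have hdiv : DifferentiableOn ℂ (fun z => deriv g z / g z) (Metric.ball 0 R) :=
    hg.deriv.differentiableOn.div hg.differentiableOn
      fun z h => hz z (mem_ball_zero_iff.1 h)
  obtain ⟨H, hH⟩ := hdiv.isExactOn_ball
  set h : ℂ → ℂ := fun z => H z - H 0 with hh
  have hd : ∀ z ∈ Metric.ball (0 : ℂ) R, HasDerivAt h (deriv g z / g z) z := fun z hzR =>
    (hH z hzR).sub_const _
  have hdo : DifferentiableOn ℂ h (Metric.ball 0 R) := fun z hzR =>
    (hd z hzR).differentiableAt.differentiableWithinAt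
  have h00 : h 0 = 0 := by simp [hh]
  have hexp : ∀ z ∈ Metric.ball (0 : ℂ) R, g z = Complex.exp (h z) := by
    have hk : ∀ z ∈ Metric.ball (0 : ℂ) R,
        HasDerivAt (fun z => g z * Complex.exp (-h z)) 0 z := by
      intro z hzR
      have h1 := (hg z).hasDerivAt.mul ((hd z hzR).neg.cexp)
      refine h1.congr_deriv ?_
      have := hz z (mem_ball_zero_iff.1 hzR)
      field_simp
      simp
    intro z hzR
    have hc := (convex_ball (0 : ℂ) R).norm_image_sub_le_of_norm_hasDerivWithin_le (C := 0)
      (fun x hx => (hk x hx).hasDerivWithinAt) (by simp) (Metric.mem_ball_self hR) hzR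
    have hc' : g z * Complex.exp (-h z) = 1 := by
      have := norm_le_zero_iff.1 (hc.trans_eq (zero_mul _))
      simpa [h0, h00, sub_eq_zero] using this
    rw [Complex.exp_neg] at hc'
    field_simp at hc'
    exact hc'
  have hre : Set.MapsTo h (Metric.ball 0 R) {z | z.re ≤ M} := by
    intro z hzR
    have := hb z (mem_ball_zero_iff.1 hzR)
    rwa [hexp z hzR, Complex.norm_exp, Real.exp_le_exp] at this
  have hB : ∀ z : ℂ, ‖z‖ ≤ R / 2 → ‖h z‖ ≤ 2 * M := by
    intro z hzR
    refine (Complex.borelCaratheodory_zero hM hdo hre hR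
      (mem_ball_zero_iff.2 (by linarith)) h00).trans ?_
    rw [div_le_iff₀ (by linarith)]
    nlinarith
  have hsub : ∀ {z : ℂ} {r s : ℝ}, ‖z‖ ≤ r → ∀ u ∈ Metric.closedBall z s, ‖u‖ ≤ r + s := by
    intro z r s hz u hu
    have := norm_le_norm_add_norm_sub' u z
    rw [mem_closedBall_iff_norm] at hu
    linarith
  have hD : ∀ z : ℂ, ‖z‖ ≤ R / 4 → ‖deriv h z‖ ≤ 8 * M / R := by
    intro z hzR
    have := Complex.norm_deriv_le_of_forall_mem_sphere_norm_le (c := z) (R := R / 4)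
      (C := 2 * M) (f := h) (by positivity) ?_ ?_
    · refine this.trans_eq ?_
      field_simp
      norm_num
    · refine hdo.diffContOnCl_ball fun u hu => ?_
      exact mem_ball_zero_iff.2 ((hsub hzR u hu).trans_lt (by linarith))
    · intro u hu
      exact hB u ((hsub hzR u (Metric.sphere_subset_closedBall hu)).trans (by linarith))
  have hdd : DifferentiableOn ℂ (deriv h) (Metric.ball 0 R) := hdo.deriv Metric.isOpen_ball
  have hDD : ∀ z : ℂ, ‖z‖ ≤ R / 8 → ‖deriv (deriv h) z‖ ≤ 64 * M / R ^ 2 := by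
    intro z hzR
    have := Complex.norm_deriv_le_of_forall_mem_sphere_norm_le (c := z) (R := R / 8)
      (C := 8 * M / R) (f := deriv h) (by positivity) ?_ ?_
    · refine this.trans_eq ?_
      field_simp
      norm_num
    · refine hdd.diffContOnCl_ball fun u hu => ?_
      exact mem_ball_zero_iff.2 ((hsub hzR u hu).trans_lt (by linarith))
    · intro u hu
      exact hD u ((hsub hzR u (Metric.sphere_subset_closedBall hu)).trans (by linarith))
  have hin : ∀ {z : ℂ}, ‖z‖ ≤ ‖w‖ → z ∈ Metric.ball (0 : ℂ) R := fun hz' =>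
    mem_ball_zero_iff.2 (by linarith)
  have hmv1 : ∀ z ∈ Metric.closedBall (0 : ℂ) ‖w‖,
      ‖deriv h z - deriv h 0‖ ≤ 64 * M / R ^ 2 * ‖w‖ := by
    intro z hzw
    have hzw' := mem_closedBall_zero_iff.1 hzw
    have := (convex_closedBall (0 : ℂ) ‖w‖).norm_image_sub_le_of_norm_deriv_le
      (f := deriv h) (C := 64 * M / R ^ 2)
      (fun x hx => hdd.differentiableAt
        (Metric.isOpen_ball.mem_nhds (hin (mem_closedBall_zero_iff.1 hx))))
      (fun x hx => hDD x (by linarith [mem_closedBall_zero_iff.1 hx]))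
      (Metric.mem_closedBall_self (norm_nonneg w)) hzw
    refine this.trans ?_
    rw [sub_zero]
    gcongr
  have hder0 : deriv h 0 = deriv g 0 := by
    rw [(hd 0 (Metric.mem_ball_self hR)).deriv, h0, div_one]
  refine ⟨h w - deriv g 0 * w, ?_, ?_⟩
  · rw [hexp w (hin le_rfl)]
    ring_nf
  · have := (convex_closedBall (0 : ℂ) ‖w‖).norm_image_sub_le_of_norm_hasDerivWithin_le
      (f := fun z => h z - deriv g 0 * z) (f' := fun z => deriv h z - deriv h 0)
      (C := 64 * M / R ^ 2 * ‖w‖) (x := 0) (y := w)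
      (fun x hx => ?_) hmv1 (Metric.mem_closedBall_self (norm_nonneg w)) (by simp)
    · simp only [h00, mul_zero, sub_zero] at this
      rwa [mul_assoc, ← sq] at this
    · have hx' := hin (mem_closedBall_zero_iff.1 hx)
      rw [hder0]
      have hlin := (hasDerivAt_id x).const_mul (deriv g 0)
      rw [mul_one] at hlin
      exact ((hd x hx').differentiableAt.hasDerivAt.sub hlin).hasDerivWithinAt

/-- Splitting off the zero of smallest modulus. -/
theorem exists_eq_one_add_mul {g : ℂ → ℂ} (hg : Differentiable ℂ g) (h0 : g 0 = 1)
    (hz : ∀ w, g w = 0 → ∃ s : ℝ, 0 < s ∧ w = -s) :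
    ∃ (a : ℝ) (g' : ℂ → ℂ), 0 ≤ a ∧ (∀ w, g w = 0 → 1 ≤ a * ‖w‖) ∧
      (∀ w, g w = (1 + a * w) * g' w) ∧ Differentiable ℂ g' ∧ g' 0 = 1 := by
  by_cases hne : ∃ w, g w = 0
  · have hcl : IsClosed (g ⁻¹' {0}) := isClosed_singleton.preimage hg.continuous
    obtain ⟨w₀, hw₀, hmin⟩ := hcl.exists_infDist_eq_dist hne 0
    obtain ⟨s, hs, rfl⟩ := hz w₀ hw₀
    have hw₀ : g (-(s : ℂ)) = 0 := hw₀
    have hsc : (s : ℂ) ≠ 0 := by exact_mod_cast hs.ne'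
    have hfac : ∀ w, g w = (1 + ((s⁻¹ : ℝ) : ℂ) * w) * (s * dslope g (-s) w) := by
      intro w
      have := sub_smul_dslope g (-(s : ℂ)) w
      rw [hw₀, sub_zero, smul_eq_mul] at this
      rw [← this]
      push_cast
      field_simp
      ring
    refine ⟨s⁻¹, fun w => s * dslope g (-s) w, by positivity, fun w hw => ?_, hfac, ?_, ?_⟩
    · have h1 : Metric.infDist 0 (g ⁻¹' {0}) ≤ dist 0 w := Metric.infDist_le_dist_of_mem hw
      rw [hmin, dist_zero_left, dist_zero_left, norm_neg, Complex.norm_of_nonneg hs.le] at h1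
      rw [inv_mul_eq_div, one_le_div hs]
      exact h1
    · have : Differentiable ℂ (dslope g (-(s : ℂ))) := by
        rw [← differentiableOn_univ, Complex.differentiableOn_dslope Filter.univ_mem]
        exact hg.differentiableOn
      exact this.const_mul _
    · have := hfac 0
      rw [h0, mul_zero, add_zero, one_mul] at this
      exact this.symm
  · exact ⟨0, g, le_rfl, fun w hw => (hne ⟨w, hw⟩).elim, by simp, hg, h0⟩

/-- Successively splitting off all zeros, in order of increasing modulus. -/
theorem exists_antitone_factorization {g : ℂ → ℂ} (hg : Differentiable ℂ g) (h0 : g 0 = 1)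
    (hz : ∀ w, g w = 0 → ∃ s : ℝ, 0 < s ∧ w = -s) :
    ∃ (a : ℕ → ℝ) (G : ℕ → ℂ → ℂ), (∀ n, 0 ≤ a n) ∧ Antitone a ∧ G 0 = g ∧
      (∀ n, Differentiable ℂ (G n)) ∧ (∀ n, G n 0 = 1) ∧
      (∀ n w, G n w = 0 → 1 ≤ a n * ‖w‖) ∧
      ∀ n w, G n w = (1 + a n * w) * G (n + 1) w := by
  let S := {u : ℂ → ℂ // Differentiable ℂ u ∧ u 0 = 1 ∧ ∀ w, u w = 0 → ∃ s : ℝ, 0 < s ∧ w = -s}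
  have step : ∀ u : S, ∃ (a : ℝ) (v : S), 0 ≤ a ∧ (∀ w, u.1 w = 0 → 1 ≤ a * ‖w‖) ∧
      ∀ w, u.1 w = (1 + a * w) * v.1 w := by
    rintro ⟨u, hu, hu0, huz⟩
    obtain ⟨a, v, ha, hmin, hfac, hv, hv0⟩ := exists_eq_one_add_mul hu hu0 huz
    exact ⟨a, ⟨v, hv, hv0, fun w hw => huz w (by rw [hfac, hw, mul_zero])⟩, ha, hmin, hfac⟩
  choose A N hA hmin hfac using step
  let G : ℕ → S := fun n => N^[n] ⟨g, hg, h0, hz⟩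
  have hG : ∀ n, G (n + 1) = N (G n) := fun n => Function.iterate_succ_apply' N n _
  have hfac' : ∀ n w, (G n).1 w = (1 + A (G n) * w) * (G (n + 1)).1 w := by
    intro n w
    rw [hG]
    exact hfac _ w
  refine ⟨fun n => A (G n), fun n => (G n).1, fun n => hA _, antitone_nat_of_succ_le fun n => ?_,
    rfl, fun n => (G n).2.1, fun n => (G n).2.2.1, fun n => hmin _, hfac'⟩
  rcases (hA (G (n + 1))).eq_or_lt with h | h
  · rw [← h]
    exact hA _
  · have hc : (A (G (n + 1)) : ℂ) ≠ 0 := by exact_mod_cast h.ne'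
    have h1 : (G (n + 1)).1 (-((A (G (n + 1)))⁻¹ : ℝ)) = 0 := by
      rw [hfac']
      push_cast
      field_simp
      simp
    have h2 := hmin (G n) _ (by rw [hfac', h1, mul_zero])
    rwa [norm_neg, Complex.norm_of_nonneg (by positivity), ← div_eq_mul_inv, one_le_div h] at h2

/-- An entire function all of whose zeros are real and negative, and which is bounded by
`C * exp (A * ‖w‖)`, is the pointwise limit of the products over its first `n` zeros, corrected by
an exponential factor matching the derivative at the origin. -/
theorem exists_tendsto_prod_mul_exp {g : ℂ → ℂ} (hg : Differentiable ℂ g) (h0 : g 0 = 1)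
    (hz : ∀ w, g w = 0 → ∃ s : ℝ, 0 < s ∧ w = -s) {C A : ℝ} (hC : 1 ≤ C) (hA : 0 ≤ A)
    (hb : ∀ w, ‖g w‖ ≤ C * Real.exp (A * ‖w‖)) :
    ∃ a : ℕ → ℝ, (∀ n, 0 ≤ a n) ∧ ∀ w : ℂ, Filter.Tendsto
      (fun n => (∏ k ∈ Finset.range n, (1 + a k * w)) *
        Complex.exp ((deriv g 0 - ∑ k ∈ Finset.range n, (a k : ℂ)) * w))
      Filter.atTop (nhds (g w)) := by
  obtain ⟨a, G, ha, hanti, hG0, hGd, hG1, hGz, hstep⟩ := exists_antitone_factorization hg h0 hz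
  refine ⟨a, ha, ?_⟩
  have hprod : ∀ n w, g w = (∏ k ∈ Finset.range n, (1 + a k * w)) * G n w := by
    intro n w
    induction n with
    | zero => simp [hG0]
    | succ n ih => rw [ih, hstep, Finset.prod_range_succ, mul_assoc]
  have hderiv : ∀ n, deriv (G n) 0 = deriv g 0 - ∑ k ∈ Finset.range n, (a k : ℂ) := by
    intro n
    induction n with
    | zero => simp [hG0]
    | succ n ih =>
      have h1 : HasDerivAt (G n) (a n + deriv (G (n + 1)) 0) 0 := by
        have hlin : HasDerivAt (fun w : ℂ => 1 + (a n : ℂ) * w) (a n) 0 := by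
          simpa using ((hasDerivAt_id (0 : ℂ)).const_mul (a n : ℂ)).const_add 1
        have h2 := hlin.mul (hGd (n + 1) 0).hasDerivAt
        have h3 : G n = (fun w : ℂ => 1 + (a n : ℂ) * w) * G (n + 1) := funext (hstep n)
        rw [h3]
        refine h2.congr_deriv ?_
        simp [hG1]
      rw [h1.deriv] at ih
      rw [Finset.sum_range_succ, ← sub_sub, ← ih]
      ring
  have hmax : ∀ (n : ℕ) (r K L : ℝ), 0 < r → 0 < L →
      (∀ w : ℂ, ‖w‖ = r → L ≤ ‖∏ k ∈ Finset.range n, (1 + a k * w)‖) →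
      (∀ w : ℂ, ‖w‖ = r → ‖g w‖ ≤ K) → ∀ w : ℂ, ‖w‖ ≤ r → ‖G n w‖ ≤ K / L := by
    intro n r K L hr hL h1 h2 w hw
    refine Complex.norm_le_of_forall_mem_frontier_norm_le (U := Metric.ball 0 r)
      Metric.isBounded_ball (hGd n).diffContOnCl (fun u hu => ?_) ?_
    · rw [frontier_ball _ hr.ne', mem_sphere_zero_iff_norm] at hu
      have h3 := h2 u hu
      rw [hprod n u, norm_mul] at h3
      rw [le_div_iff₀ hL, mul_comm]
      exact (mul_le_mul_of_nonneg_right (h1 u hu) (norm_nonneg _)).trans h3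
    · rwa [closure_ball _ hr.ne', mem_closedBall_zero_iff]
  have hbr : ∀ (r : ℝ) (w : ℂ), ‖w‖ = r → ‖g w‖ ≤ C * Real.exp (A * r) := by
    rintro r w rfl
    exact hb w
  have hfactor : ∀ (k : ℕ) (w : ℂ), a k * ‖w‖ - 1 ≤ ‖1 + (a k : ℂ) * w‖ := by
    intro k w
    have := norm_sub_le_norm_add (a k * w : ℂ) 1
    rwa [norm_mul, Complex.norm_of_nonneg (ha k), norm_one, add_comm] at this
  have hsmall : ∀ ε : ℝ, 0 < ε → ∃ n, a n < ε := by
    intro ε hε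
    by_contra! hcon
    obtain ⟨n, hn⟩ := pow_unbounded_of_one_lt (C * Real.exp (A * (3 / ε))) one_lt_two
    have := hmax n (3 / ε) _ (2 ^ n) (by positivity) (by positivity) (fun w hw => ?_)
      (hbr (3 / ε)) 0 (by simpa using by positivity)
    · rw [hG1, norm_one, le_div_iff₀ (by positivity)] at this
      linarith
    · rw [norm_prod]
      calc (2 : ℝ) ^ n = ∏ _k ∈ Finset.range n, 2 := by simp
        _ ≤ _ := Finset.prod_le_prod (fun _ _ => by norm_num) fun k _ => by
          refine le_trans ?_ (hfactor k w)
          rw [hw]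
          have := mul_le_mul_of_nonneg_right (hcon k) (show 0 ≤ 3 / ε by positivity)
          rw [mul_div_cancel₀ _ hε.ne'] at this
          linarith
  have herr : ∀ (w : ℂ) (n : ℕ) (R : ℝ), 1 ≤ R → 16 * ‖w‖ ≤ R → a n * R ≤ 1 →
      (∀ k < n, a k = 0 ∨ 1 ≤ a k * R) →
      ∃ e : ℂ, G n w = Complex.exp (deriv (G n) 0 * w + e) ∧
        ‖e‖ ≤ 64 * (Real.log C + 2 * A + 1) * ‖w‖ ^ 2 / R := by
    intro w n R hR hwR han hak
    have hlC : 0 ≤ Real.log C := Real.log_nonneg hC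
    have hCe : C * Real.exp (A * (2 * R)) ≤ Real.exp ((Real.log C + 2 * A + 1) * R) := by
      nth_rw 1 [← Real.exp_log (zero_lt_one.trans_le hC)]
      rw [← Real.exp_add, Real.exp_le_exp]
      nlinarith
    have hne : ∀ z, ‖z‖ < R → G n z ≠ 0 := by
      intro z hzR h
      have h1 := hGz n z h
      rcases (ha n).eq_or_lt with h2 | h2
      · rw [← h2] at h1
        linarith
      · nlinarith
    have hbd : ∀ z, ‖z‖ < R → ‖G n z‖ ≤ Real.exp ((Real.log C + 2 * A + 1) * R) := by
      intro z hzR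
      have := hmax n (2 * R) _ 1 (by linarith) one_pos (fun u hu => ?_) (hbr (2 * R)) z
        (by linarith)
      · rw [div_one] at this
        exact this.trans hCe
      · rw [norm_prod]
        refine Finset.one_le_prod fun k hk => ?_
        rcases hak k (Finset.mem_range.1 hk) with h | h
        · simp [h]
        · have := hfactor k u
          rw [hu] at this
          linarith
    obtain ⟨e, he, hle⟩ := exists_eq_exp_deriv_mul_add (hGd n) (hG1 n) (by linarith)
      (by positivity) hne hbd (w := w) (by linarith)
    refine ⟨e, he, hle.trans_eq ?_⟩
    field_simp
  intro w
  have hcont : Filter.Tendsto (fun e : ℂ => g w * Complex.exp (-e)) (nhds 0) (nhds (g w)) := by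
    have : Continuous fun e : ℂ => g w * Complex.exp (-e) := by fun_prop
    simpa using this.tendsto 0
  rw [Metric.tendsto_atTop]
  intro ε hε
  obtain ⟨δ, hδ, hδε⟩ := Metric.tendsto_nhds_nhds.1 hcont ε hε
  set K := 64 * (Real.log C + 2 * A + 1) * ‖w‖ ^ 2 with hK
  have hK0 : 0 ≤ K := by
    have := Real.log_nonneg hC
    positivity
  set T := 1 + 16 * ‖w‖ + (K + 1) / δ with hT
  have hT0 : 0 < T := by positivity
  obtain ⟨N, hN⟩ := hsmall T⁻¹ (by positivity)
  refine ⟨N, fun n hn => ?_⟩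
  have hanT : a n * T ≤ 1 := by
    rw [← le_div_iff₀ hT0, one_div]
    exact (hanti hn).trans hN.le
  obtain ⟨R, hRT, hRn, hRk⟩ : ∃ R, T ≤ R ∧ a n * R ≤ 1 ∧ ∀ k < n, a k = 0 ∨ 1 ≤ a k * R := by
    rcases (ha n).eq_or_lt with h | h
    · have hnn : ∀ k ∈ Finset.range n, 0 ≤ (a k)⁻¹ := fun k _ => inv_nonneg.2 (ha k)
      refine ⟨T + ∑ k ∈ Finset.range n, (a k)⁻¹,
        le_add_of_nonneg_right (Finset.sum_nonneg hnn), by simp [← h], fun k hk => ?_⟩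
      rcases (ha k).eq_or_lt with h' | h'
      · exact Or.inl h'.symm
      · right
        have h1 := Finset.single_le_sum hnn (Finset.mem_range.2 hk)
        have h2 := mul_le_mul_of_nonneg_left (h1.trans (le_add_of_nonneg_left hT0.le)) h'.le
        rwa [mul_inv_cancel₀ h'.ne'] at h2
    · refine ⟨(a n)⁻¹, by rwa [← one_div, le_div_iff₀ h, mul_comm],
        (mul_inv_cancel₀ h.ne').le, fun k hk => Or.inr ?_⟩
      rw [← div_eq_mul_inv, one_le_div h]
      exact hanti hk.le
  have hq : 0 ≤ (K + 1) / δ := by positivity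
  obtain ⟨e, he, hle⟩ := herr w n R (by linarith [norm_nonneg w]) (by linarith) hRn hRk
  have hed : ‖e‖ < δ := by
    refine hle.trans_lt ?_
    rw [div_lt_iff₀ (by linarith)]
    have h1 : (K + 1) / δ ≤ R := by linarith [norm_nonneg w]
    rw [div_le_iff₀ hδ] at h1
    linarith
  have := hδε (x := e) (by simpa using hed)
  rwa [hprod n w, he, mul_assoc, ← Complex.exp_add, add_neg_cancel_right, ← he,
    ← hprod, hderiv] at this

/-- Hadamard factorization with summable reciprocal zeros, for entire functions of exponential
type whose zeros are real and negative and whose modulus is at least one on the positive reals. -/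
theorem exists_eq_exp_mul_tprod {g : ℂ → ℂ} (hg : Differentiable ℂ g) (h0 : g 0 = 1)
    (hz : ∀ w, g w = 0 → ∃ s : ℝ, 0 < s ∧ w = -s) {C A β : ℝ} (hC : 1 ≤ C) (hA : 0 ≤ A)
    (hb : ∀ w, ‖g w‖ ≤ C * Real.exp (A * ‖w‖)) (hβ : deriv g 0 = β)
    (hpos : ∀ t : ℝ, 0 ≤ t → 1 ≤ ‖g t‖) :
    ∃ (B : ℝ) (a : ℕ → ℝ), 0 ≤ B ∧ (∀ k, 0 ≤ a k) ∧ Summable a ∧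
      (∀ w : ℂ, g w = Complex.exp (B * w) * ∏' k, (1 + (a k : ℂ) * w)) ∧
      β = B + ∑' k, a k := by
  obtain ⟨a, ha, hlim⟩ := exists_tendsto_prod_mul_exp hg h0 hz hC hA hb
  rw [hβ] at hlim
  have hone : ∀ (n : ℕ) (t : ℝ), 0 ≤ t → 1 ≤ (∏ k ∈ Finset.range n, (1 + a k * t)) *
      Real.exp ((β - ∑ k ∈ Finset.range n, a k) * t) := by
    intro n t ht
    have hfac : ∀ k, 0 ≤ 1 + a k * t := fun k => by have := mul_nonneg (ha k) ht; linarith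
    have hanti : Antitone fun n => (∏ k ∈ Finset.range n, (1 + a k * t)) *
        Real.exp ((β - ∑ k ∈ Finset.range n, a k) * t) := by
      refine antitone_nat_of_succ_le fun n => ?_
      rw [Finset.prod_range_succ, Finset.sum_range_succ, mul_assoc]
      refine mul_le_mul_of_nonneg_left ?_ (Finset.prod_nonneg fun k _ => hfac k)
      calc (1 + a n * t) * Real.exp ((β - (∑ k ∈ Finset.range n, a k + a n)) * t)
          ≤ Real.exp (a n * t) * Real.exp ((β - (∑ k ∈ Finset.range n, a k + a n)) * t) := by
            gcongr
            linarith [Real.add_one_le_exp (a n * t)]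
        _ = _ := by
            rw [← Real.exp_add]
            ring_nf
    refine (hpos t ht).trans (hanti.le_of_tendsto ?_ n)
    refine (hlim t).norm.congr fun n => ?_
    rw [norm_mul, Complex.norm_exp, norm_prod]
    congr 1
    · refine Finset.prod_congr rfl fun k _ => ?_
      rw [← Complex.norm_of_nonneg (hfac k)]
      push_cast
      rfl
    · norm_cast
  have hsum : ∀ n, ∑ k ∈ Finset.range n, a k ≤ β := by
    intro n
    by_contra! hlt
    set S := ∑ k ∈ Finset.range n, a k with hS
    set T := ∑ k ∈ Finset.range n, √(a k) with hT
    have hT0 : 0 ≤ T := Finset.sum_nonneg fun k _ => Real.sqrt_nonneg _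
    set s := (2 * T + 1) / (S - β) with hs
    have hs0 : 0 < s := div_pos (by linarith) (by linarith)
    have h1 : ∏ k ∈ Finset.range n, (1 + a k * s ^ 2) ≤ Real.exp (2 * T * s) := by
      rw [hT, Finset.mul_sum, Finset.sum_mul, Real.exp_sum]
      refine Finset.prod_le_prod (fun k _ => by have := ha k; positivity) fun k _ => ?_
      have h2 := Real.add_one_le_exp (√(a k) * s)
      have h3 : 0 ≤ √(a k) * s := by positivity
      calc 1 + a k * s ^ 2 = 1 + (√(a k) * s) ^ 2 := by rw [mul_pow, Real.sq_sqrt (ha k)]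
        _ ≤ (√(a k) * s + 1) ^ 2 := by nlinarith
        _ ≤ Real.exp (√(a k) * s) ^ 2 := by gcongr
        _ = _ := by
          rw [← Real.exp_nat_mul]
          push_cast
          ring_nf
    have h2 := (hone n (s ^ 2) (by positivity)).trans
      (mul_le_mul_of_nonneg_right h1 (Real.exp_nonneg _))
    rw [← Real.exp_add, Real.one_le_exp_iff] at h2
    have h3 : s * (S - β) = 2 * T + 1 := div_mul_cancel₀ _ (by linarith)
    nlinarith
  have hsa : Summable a := summable_of_sum_range_le ha hsum
  refine ⟨β - ∑' k, a k, a, sub_nonneg.2 (hsa.tsum_le_of_sum_range_le hsum), ha, hsa,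
    fun w => ?_, by ring⟩
  refine tendsto_nhds_unique (hlim w) ?_
  rw [mul_comm]
  have hm : Multipliable fun k => 1 + (a k : ℂ) * w := by
    refine multipliable_one_add_of_summable ?_
    simpa [abs_of_nonneg (ha _)] using hsa.mul_right ‖w‖
  refine hm.hasProd.tendsto_prod_nat.mul ((Complex.continuous_exp.tendsto _).comp ?_)
  rw [Complex.ofReal_sub]
  refine (tendsto_const_nhds.sub ?_).mul_const w
  exact (Complex.hasSum_ofReal.2 hsa.hasSum).tendsto_sum_nat

/-- An even entire function is an entire function of the square of its argument. -/
theorem exists_differentiable_comp_sq {f : ℂ → ℂ} (hf : Differentiable ℂ f)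
    (heven : ∀ z, f (-z) = f z) :
    ∃ g : ℂ → ℂ, Differentiable ℂ g ∧ ∀ z, f z = g (z ^ 2) := by
  have hsq : ∀ w : ℂ, (w ^ (1 / 2 : ℂ)) ^ 2 = w := fun w => by simp
  have hroot : ∀ u v : ℂ, u ^ 2 = v ^ 2 → f u = f v := fun u v h => by
    rcases sq_eq_sq_iff_eq_or_eq_neg.1 h with rfl | rfl
    · rfl
    · exact heven v
  set g : ℂ → ℂ := fun w => f (w ^ (1 / 2 : ℂ)) with hg
  have hfg : ∀ z, f z = g (z ^ 2) := fun z => hroot _ _ (hsq _).symm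
  refine ⟨g, ?_, hfg⟩
  rw [← differentiableOn_univ,
    ← Complex.differentiableOn_compl_singleton_and_continuousAt_iff (c := 0) Filter.univ_mem]
  constructor
  · rintro w ⟨-, hw⟩
    refine DifferentiableAt.differentiableWithinAt ?_
    have hw : w ≠ 0 := hw
    by_cases hs : w ∈ Complex.slitPlane
    · exact (hf _).comp w (differentiableAt_id.cpow_const hs)
    · have hs' : -w ∈ Complex.slitPlane := by
        have := (Complex.mem_slitPlane_or_neg_mem_slitPlane hw).resolve_left hs
        exact this
      have hgw : g = fun w => f (Complex.I * (-w) ^ (1 / 2 : ℂ)) := by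
        funext w
        refine hroot _ _ ?_
        rw [hsq, mul_pow, hsq, Complex.I_sq]
        ring
      rw [hgw]
      exact (hf _).comp w ((differentiableAt_id.neg.cpow_const hs').const_mul _)
  · refine (hf.continuous.continuousAt).comp ?_
    exact Complex.continuousAt_cpow_const_of_re_pos (Or.inl le_rfl) (by norm_num)

section Moments

open ProbabilityTheory

variable {Ω : Type*} [MeasurableSpace Ω] {P : Measure Ω} {X : Ω → ℝ}

/-- A square-exponentially integrable random variable has all exponential moments. -/
theorem integrable_exp_mul_of_integrable_exp_sq (hX : Measurable X) {b : ℝ} (hb : 0 < b)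
    (hint : Integrable (fun ω => Real.exp (b * X ω ^ 2)) P) (t : ℝ) :
    Integrable (fun ω => Real.exp (t * X ω)) P ∧
      mgf X P t ≤ Real.exp (t ^ 2 / (4 * b)) * ∫ ω, Real.exp (b * X ω ^ 2) ∂P := by
  have hle : ∀ ω, Real.exp (t * X ω) ≤ Real.exp (t ^ 2 / (4 * b)) * Real.exp (b * X ω ^ 2) := by
    intro ω
    rw [← Real.exp_add, Real.exp_le_exp]
    have h : t ^ 2 / (4 * b) + b * X ω ^ 2 - t * X ω = (t - 2 * b * X ω) ^ 2 / (4 * b) := by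
      field_simp
      ring
    have : 0 ≤ (t - 2 * b * X ω) ^ 2 / (4 * b) := by positivity
    linarith
  have hi : Integrable (fun ω => Real.exp (t * X ω)) P := by
    refine (hint.const_mul (Real.exp (t ^ 2 / (4 * b)))).mono' (by fun_prop) (.of_forall ?_)
    intro ω
    rw [Real.norm_of_nonneg (Real.exp_nonneg _)]
    exact hle ω
  refine ⟨hi, ?_⟩
  rw [← integral_const_mul]
  exact integral_mono hi (hint.const_mul _) hle

end Moments

/-- Hadamard product expansion for moment generating functions of Lee–Yang type random
variables: `f(z) = e^{Bz²} ∏_k (1 + a_k z²)` with `B ≥ 0`, `a_k ≥ 0` summable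
(here `a_k = 1/y_k²` for the pure imaginary zeros `± i y_k`), and
`E[X²] = Var[X] = 2(B + ∑_k a_k)`. -/
theorem leeYang_product_expansion
    {Ω : Type*} [MeasurableSpace Ω] (P : Measure Ω) [IsProbabilityMeasure P]
    (X : Ω → ℝ) (hX : Measurable X) (hLY : IsLeeYangRV P X) :
    ∃ (B : ℝ) (a : ℕ → ℝ), 0 ≤ B ∧ (∀ k, 0 ≤ a k) ∧ Summable a ∧
      (∀ z : ℂ, (∫ ω, Complex.exp (z * (X ω : ℂ)) ∂P)
        = Complex.exp ((B : ℂ) * z ^ 2) * ∏' k, (1 + (a k : ℂ) * z ^ 2)) ∧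
      (∫ ω, (X ω) ^ 2 ∂P) = 2 * (B + ∑' k, a k) ∧
      ProbabilityTheory.variance X P = 2 * (B + ∑' k, a k) := by
  obtain ⟨hsymm, ⟨b, hb, hint⟩, hne⟩ := hLY
  have hmgf := integrable_exp_mul_of_integrable_exp_sq hX hb hint
  have hset : ∀ t : ℝ, t ∈ interior (ProbabilityTheory.integrableExpSet X P) := by
    have : ProbabilityTheory.integrableExpSet X P = Set.univ :=
      Set.eq_univ_of_forall fun t => (hmgf t).1
    simp [this]
  have hid : ProbabilityTheory.IdentDistrib (fun ω => -X ω) X P P :=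
    ⟨hX.neg.aemeasurable, hX.aemeasurable, hsymm⟩
  set f : ℂ → ℂ := ProbabilityTheory.complexMGF X P with hf
  have hd1 : ∀ z, HasDerivAt f (∫ ω, (X ω : ℂ) * Complex.exp (z * X ω) ∂P) z := fun z =>
    ProbabilityTheory.hasDerivAt_complexMGF (hset _)
  have hd2 : HasDerivAt (fun z => ∫ ω, (X ω : ℂ) * Complex.exp (z * X ω) ∂P)
      ((∫ ω, X ω ^ 2 ∂P : ℝ) : ℂ) 0 := by
    have := ProbabilityTheory.hasDerivAt_integral_pow_mul_exp (z := 0) (hset _) 1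
    simp only [pow_one, zero_mul, Complex.exp_zero, mul_one, one_add_one_eq_two] at this
    refine this.congr_deriv ?_
    rw [← integral_complex_ofReal]
    push_cast
    rfl
  have heven : ∀ z, f (-z) = f z := by
    intro z
    have := congrFun (ProbabilityTheory.complexMGF_congr_identDistrib hid) z
    rw [hf, ← this]
    simp [ProbabilityTheory.complexMGF]
  have hmean : ∫ ω, X ω ∂P = 0 := by
    have := hid.integral_eq
    rw [integral_neg] at this
    linarith
  have hf0 : f 0 = 1 := by simp [hf, ProbabilityTheory.complexMGF]
  have hX1 : Integrable X P := ProbabilityTheory.integrable_of_mem_interior_integrableExpSet (hset 0)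
  have hone : ∀ t : ℝ, 1 ≤ ProbabilityTheory.mgf X P t := by
    intro t
    have h1 : ∫ ω, (t * X ω + 1) ∂P = 1 := by
      rw [integral_add (hX1.const_mul t) (integrable_const 1), integral_const_mul, hmean]
      simp
    rw [← h1]
    exact integral_mono ((hX1.const_mul t).add (integrable_const 1)) (hmgf t).1
      fun ω => Real.add_one_le_exp _
  obtain ⟨g, hg, hfg⟩ := exists_differentiable_comp_sq (fun z => (hd1 z).differentiableAt) heven
  have hroot : ∀ w : ℂ, ∃ z : ℂ, z ^ 2 = w := fun w => IsAlgClosed.exists_pow_nat_eq w two_pos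
  have hg0 : g 0 = 1 := by simpa [hf0] using (hfg 0).symm
  have hgder : deriv g 0 = ((∫ ω, X ω ^ 2 ∂P) / 2 : ℝ) := by
    have h1 : (fun z => ∫ ω, (X ω : ℂ) * Complex.exp (z * X ω) ∂P) =
        fun z => deriv g (z ^ 2) * (2 * z) := by
      funext z
      refine (hd1 z).unique ?_
      have h2 := (hg (z ^ 2)).hasDerivAt.comp z (hasDerivAt_pow 2 z)
      rw [funext hfg]
      simpa [Function.comp_def] using h2
    rw [h1] at hd2
    have h3 : HasDerivAt (fun z : ℂ => deriv g (z ^ 2) * (2 * z)) (deriv g 0 * 2) 0 := by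
      have h4 : DifferentiableAt ℂ (fun z : ℂ => deriv g (z ^ 2)) 0 :=
        (hg.deriv.comp (differentiable_pow 2)).differentiableAt
      have h5 := h4.hasDerivAt.mul ((hasDerivAt_id (0 : ℂ)).const_mul 2)
      refine h5.congr_deriv ?_
      simp
    have h6 := hd2.unique h3
    push_cast
    rw [h6]
    ring
  have hzeros : ∀ w, g w = 0 → ∃ s : ℝ, 0 < s ∧ w = -s := by
    intro w hw
    obtain ⟨z, rfl⟩ := hroot w
    have hre : z.re = 0 := by
      by_contra h
      exact hne z h ((hfg z).trans hw)
    have hz : z = z.im * Complex.I := by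
      apply Complex.ext <;> simp [hre]
    have him : z.im ≠ 0 := by
      intro h
      rw [h, Complex.ofReal_zero, zero_mul] at hz
      rw [hz] at hw
      simp [hg0] at hw
    refine ⟨z.im ^ 2, by positivity, ?_⟩
    conv_lhs => rw [hz, mul_pow, Complex.I_sq]
    push_cast
    ring
  have hC : 1 ≤ ∫ ω, Real.exp (b * X ω ^ 2) ∂P := by
    have := (hmgf 0).2
    simpa using this
  have hgrowth : ∀ w, ‖g w‖ ≤
      (∫ ω, Real.exp (b * X ω ^ 2) ∂P) * Real.exp (1 / (4 * b) * ‖w‖) := by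
    intro w
    obtain ⟨z, rfl⟩ := hroot w
    rw [← hfg, mul_comm]
    refine (ProbabilityTheory.norm_complexMGF_le_mgf.trans (hmgf z.re).2).trans ?_
    refine mul_le_mul_of_nonneg_right ?_ (integral_nonneg fun ω => Real.exp_nonneg _)
    rw [Real.exp_le_exp, norm_pow, div_eq_inv_mul, one_div]
    have : z.re ^ 2 ≤ ‖z‖ ^ 2 := by
      rw [← sq_abs]
      gcongr
      exact Complex.abs_re_le_norm z
    gcongr
  have hge : ∀ t : ℝ, 0 ≤ t → 1 ≤ ‖g t‖ := by
    intro t ht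
    have h1 : g t = (ProbabilityTheory.mgf X P √t : ℝ) := by
      rw [← ProbabilityTheory.complexMGF_ofReal, ← hf, hfg, ← Complex.ofReal_pow, Real.sq_sqrt ht]
    rw [h1, Complex.norm_of_nonneg (zero_le_one.trans (hone _))]
    exact hone _
  obtain ⟨B, a, hB, ha, hsum, hprod, hβ⟩ := exists_eq_exp_mul_tprod hg hg0 hzeros hC
    (A := 1 / (4 * b)) (by positivity) hgrowth hgder hge
  have hvar : ∫ ω, X ω ^ 2 ∂P = 2 * (B + ∑' k, a k) := by linarith
  refine ⟨B, a, hB, ha, hsum, fun z => ?_, hvar, ?_⟩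
  · rw [← hprod, ← hfg]
    rfl
  · rw [ProbabilityTheory.variance_of_integral_eq_zero hX.aemeasurable hmean, ← hvar]
end
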